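/- arXiv:2305.11836 — 2 statements merged into one kernel-verified Lean document; each statement's English description precedes it below -/
import Mathlib

section
/- Hopf-type lemma at the vertex, half-space instance (Theorem 1.4 for the fractional Laplacian, where β⁻ = −α). Let N ≥ 2, α ∈ (0,1), H = {x ∈ ℝ^N : x_N > 0}. Let u : ℝ^N → ℝ be bounded and continuous with u(x) > 0 for all x ∈ H and u(x) = 0 for all x ∈ ℝ^N ∖ H (in particular u(0) = 0), and assume that for every x ∈ H the function y ↦ δ(u,x,y) |y|^{−(N+2α)} is Lebesgue integrable with ∫_{ℝ^N} δ(u,x,y) |y|^{−(N+2α)} dy ≤ 0. Then for every compact set ω₀ contained in the open upper hemisphere {e ∈ S^{N−1} : e_N > 0} and every β ∈ (−2α, −α), there exist constants C > 0 and t₀ > 0 such that u(t e) ≥ C t^{−β} for all e ∈ ω₀ and all t ∈ (0, t₀). -/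
open MeasureTheory

/-- The nonlocal second difference `δ(u,x,y) = u(x+y) + u(x-y) - 2u(x)`. -/
noncomputable def nlD {N : ℕ} (u : EuclideanSpace ℝ (Fin N) → ℝ)
    (x y : EuclideanSpace ℝ (Fin N)) : ℝ :=
  u (x + y) + u (x - y) - 2 * u x


/-- one-dimensional profile -/
noncomputable def hG (γ s : ℝ) : ℝ := (max (1 + s) 0) ^ γ + (max (1 - s) 0) ^ γ - 2

lemma hG_neg (γ s : ℝ) : hG γ (-s) = hG γ s := by
  unfold hG; rw [sub_neg_eq_add, ← sub_eq_add_neg]; ring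

lemma hG_abs' (γ s : ℝ) : hG γ |s| = hG γ s := by
  rcases abs_choice s with h | h <;> rw [h]
  exact hG_neg γ s

lemma hG_cont (γ : ℝ) (h : 0 < γ) : Continuous (hG γ) := by
  unfold hG
  have h1 : Continuous fun s : ℝ => (max (1 + s) 0) ^ γ :=
    (by fun_prop : Continuous fun s : ℝ => max (1 + s) 0).rpow_const (fun _ => Or.inr h.le)
  have h2 : Continuous fun s : ℝ => (max (1 - s) 0) ^ γ :=
    (by fun_prop : Continuous fun s : ℝ => max (1 - s) 0).rpow_const (fun _ => Or.inr h.le)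
  exact (h1.add h2).sub continuous_const

lemma aux_lower (γ s : ℝ) (h0 : 0 < γ) (h1 : γ < 1) (hs : -1 < s) (hs1 : s < 1) :
    1 + γ * s - (1 - γ) * s ^ 2 ≤ (1 + s) ^ γ := by
  have hp : 0 < 1 + s := by linarith
  have hb := rpow_one_add_le_one_add_mul_self hs.le (p := 1 - γ) (by linarith) (by linarith)
  have he : (1 + s) ^ γ * (1 + s) ^ (1 - γ) = 1 + s := by
    rw [← Real.rpow_add hp]; simp
  have hX : 0 < (1 + s) ^ γ := Real.rpow_pos_of_pos hp _
  have hY : 0 < (1 + s) ^ (1 - γ) := Real.rpow_pos_of_pos hp _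
  have h2 : 1 + s ≤ (1 + s) ^ γ * (1 + (1 - γ) * s) := by
    calc 1 + s = (1 + s) ^ γ * (1 + s) ^ (1 - γ) := he.symm
      _ ≤ _ := by gcongr
  have h3 : 0 < 1 - (1 - γ) * s := by nlinarith
  have h4 : (1 + s) * (1 - (1 - γ) * s) ≤ (1 + s) ^ γ * (1 + (1 - γ) * s) * (1 - (1 - γ) * s) :=
    mul_le_mul_of_nonneg_right h2 h3.le
  nlinarith [mul_nonneg hX.le (sq_nonneg ((1 - γ) * s))]

lemma hG_small_lower (γ s : ℝ) (h0 : 0 < γ) (h1 : γ < 1) (hs : 0 ≤ s) (hs1 : s < 1) :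
    - 2 * s ^ 2 ≤ hG γ s := by
  unfold hG
  rw [max_eq_left (by linarith), max_eq_left (by linarith)]
  have := aux_lower γ s h0 h1 (by linarith) hs1
  have := aux_lower γ (-s) h0 h1 (by linarith) (by linarith)
  rw [← sub_eq_add_neg] at this
  nlinarith

lemma hG_upper (γ s : ℝ) (h0 : 0 < γ) (h1 : γ < 1) : hG γ s ≤ |s| ^ γ := by
  rw [← hG_abs']
  have hs := abs_nonneg s
  generalize |s| = s at *
  unfold hG
  rw [max_eq_left (by linarith)]
  have := Real.rpow_add_le_add_rpow zero_le_one hs h0.le h1.le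
  have h2 : (max (1 - s) 0) ^ γ ≤ 1 :=
    Real.rpow_le_one (le_max_right _ _) (max_le (by linarith) (by norm_num)) h0.le
  rw [Real.one_rpow] at this
  linarith

lemma hG_abs_le (γ s : ℝ) (h0 : 0 < γ) (h1 : γ < 1) :
    |hG γ s| ≤ 2 * min (|s| ^ (2:ℝ)) (|s| ^ γ) := by
  have hu := hG_upper γ s h0 h1
  rw [← hG_abs'] at hu ⊢
  have hs := abs_nonneg s
  generalize |s| = s at *
  rcases lt_or_ge s 1 with h | h
  · have hm : min (s ^ (2:ℝ)) (s ^ γ) = s ^ 2 := by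
      rw [Real.rpow_two, min_eq_left]
      rcases hs.eq_or_lt with h' | h'
      · rw [← h', Real.zero_rpow h0.ne']; norm_num
      rw [← Real.rpow_two]
      exact Real.rpow_le_rpow_of_exponent_ge h' h.le (by linarith)
    rw [hm]
    have h3 := hG_small_lower γ s h0 h1 hs h
    have h4 : hG γ s ≤ 0 := by
      unfold hG
      rw [max_eq_left (by linarith), max_eq_left (by linarith)]
      have := rpow_one_add_le_one_add_mul_self (s := s) (by linarith) h0.le h1.le
      have := rpow_one_add_le_one_add_mul_self (s := -s) (by linarith) h0.le h1.le
      rw [← sub_eq_add_neg] at this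
      linarith
    rw [abs_of_nonpos h4]; linarith
  · have hm : min (s ^ (2:ℝ)) (s ^ γ) = s ^ γ := by
      rw [min_eq_right]
      exact Real.rpow_le_rpow_of_exponent_le h (by linarith)
    rw [hm]
    have h5 : 1 ≤ s ^ γ := Real.one_le_rpow h h0.le
    have h6 : -2 ≤ hG γ s := by
      unfold hG
      have : 0 ≤ (max (1 + s) 0) ^ γ := by positivity
      have : 0 ≤ (max (1 - s) 0) ^ γ := by positivity
      linarith
    rw [abs_le]; constructor <;> linarith

lemma oneD_min_integrable (a b α : ℝ) (hb : b < 2 * α) (ha : 2 * α < a) :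
    IntegrableOn (fun r : ℝ => min (r ^ a) (r ^ b) * r ^ (-1 - 2 * α)) (Set.Ioi 0) := by
  have hm : AEStronglyMeasurable (fun r : ℝ => min (r ^ a) (r ^ b) * r ^ (-1 - 2 * α)) volume :=
    (by fun_prop : Measurable _).aestronglyMeasurable
  rw [← Set.Ioc_union_Ioi_eq_Ioi zero_le_one]
  refine IntegrableOn.union ?_ ?_
  · have hi : IntegrableOn (fun r : ℝ => r ^ (a - 1 - 2 * α)) (Set.Ioc 0 1) := by
      rw [integrableOn_Ioc_iff_integrableOn_Ioo, intervalIntegral.integrableOn_Ioo_rpow_iff one_pos]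
      linarith
    refine hi.mono' hm.restrict ?_
    refine (ae_restrict_iff' measurableSet_Ioc).2 (ae_of_all _ fun r hr => ?_)
    have h0 : 0 < r := hr.1
    rw [Real.norm_of_nonneg (by positivity), show a - 1 - 2 * α = a + (-1 - 2 * α) by ring,
      Real.rpow_add h0]
    gcongr
    exact min_le_left _ _
  · have hi : IntegrableOn (fun r : ℝ => r ^ (b - 1 - 2 * α)) (Set.Ioi 1) :=
      integrableOn_Ioi_rpow_of_lt (by linarith) one_pos
    refine hi.mono' hm.restrict ?_
    refine (ae_restrict_iff' measurableSet_Ioi).2 (ae_of_all _ fun r hr => ?_)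
    have h0 : 0 < r := lt_trans one_pos hr
    rw [Real.norm_of_nonneg (by positivity), show b - 1 - 2 * α = b + (-1 - 2 * α) by ring,
      Real.rpow_add h0]
    gcongr
    exact min_le_right _ _

lemma nD_min_integrable (N : ℕ) (hN : 2 ≤ N) (a b α : ℝ) (hb : b < 2 * α) (ha : 2 * α < a) :
    Integrable (fun y : EuclideanSpace ℝ (Fin N) =>
      min (‖y‖ ^ a) (‖y‖ ^ b) * ‖y‖ ^ (-((N : ℝ) + 2 * α))) := by
  have : Nonempty (Fin N) := ⟨⟨0, by omega⟩⟩
  have : Nontrivial (EuclideanSpace ℝ (Fin N)) := by infer_instance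
  rw [integrable_fun_norm_addHaar volume
    (f := fun r : ℝ => min (r ^ a) (r ^ b) * r ^ (-((N : ℝ) + 2 * α)))]
  refine (oneD_min_integrable a b α hb ha).congr_fun (fun r hr => ?_) measurableSet_Ioi
  have h0 : (0:ℝ) < r := hr
  simp only [finrank_euclideanSpace, Fintype.card_fin, smul_eq_mul]
  rw [mul_left_comm]
  congr 1
  rw [← Real.rpow_natCast, ← Real.rpow_add h0]
  congr 1
  push_cast [Nat.cast_sub (by omega : 1 ≤ N)]
  ring

lemma hG_oneD_integrable (γ α : ℝ) (h0 : 0 < γ) (h1 : γ < 1) (h2 : γ < 2 * α) (hα : α < 1) :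
    IntegrableOn (fun r : ℝ => hG γ r * r ^ (-1 - 2 * α)) (Set.Ioi 0) := by
  refine ((oneD_min_integrable 2 γ α h2 (by linarith)).const_mul 2).mono'
    (((hG_cont γ h0).measurable.mul (by fun_prop)).aestronglyMeasurable) ?_
  refine (ae_restrict_iff' measurableSet_Ioi).2 (ae_of_all _ fun r hr => ?_)
  have hr0 : 0 < r := hr
  have := hG_abs_le γ r h0 h1
  rw [abs_of_pos hr0] at this
  rw [norm_mul, Real.norm_eq_abs, Real.norm_of_nonneg (by positivity), ← mul_assoc]
  gcongr

lemma hG_nD_integrable (N : ℕ) (hN : 2 ≤ N) (γ α : ℝ) (h0 : 0 < γ) (h1 : γ < 1)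
    (h2 : γ < 2 * α) (hα : α < 1) (e : EuclideanSpace ℝ (Fin N)) (he : ‖e‖ = 1) :
    Integrable (fun y : EuclideanSpace ℝ (Fin N) =>
      hG γ (inner ℝ y e) * ‖y‖ ^ (-((N : ℝ) + 2 * α))) := by
  refine ((nD_min_integrable N hN 2 γ α h2 (by linarith)).const_mul 2).mono'
    ((((hG_cont γ h0).measurable.comp (by fun_prop)).mul (by fun_prop)).aestronglyMeasurable) ?_
  refine ae_of_all _ fun y => ?_
  have := hG_abs_le γ (inner ℝ y e) h0 h1
  have hc : |inner ℝ y e| ≤ ‖y‖ := by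
    have := abs_real_inner_le_norm y e
    rwa [he, mul_one] at this
  rw [norm_mul, Real.norm_eq_abs, Real.norm_of_nonneg (by positivity), ← mul_assoc]
  refine mul_le_mul_of_nonneg_right (this.trans ?_) (by positivity)
  gcongr

/-- difference of the transformed integrands for exponents `γ` and `α` -/
noncomputable def hD (γ α v : ℝ) : ℝ :=
  (((1 - v) ^ γ - 1) + ((1 - v) ^ (2 * α - 1 - γ) - (1 - v) ^ (2 * α - 1))
    - (1 - (1 - v) ^ α) * ((1 - v) ^ (α - 1) - 1)) * v ^ (-1 - 2 * α)

lemma hD_pos (γ α v : ℝ) (h : α < γ) (hv : 0 < v) (hv1 : v < 1) : 0 < hD γ α v := by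
  unfold hD
  refine mul_pos ?_ (Real.rpow_pos_of_pos hv _)
  have hs : 0 < 1 - v := by linarith
  have hs1 : 1 - v < 1 := by linarith
  generalize 1 - v = s at *
  have e : (s ^ γ - 1) + (s ^ (2 * α - 1 - γ) - s ^ (2 * α - 1))
    - (1 - s ^ α) * (s ^ (α - 1) - 1) = (1 - s ^ (γ - α)) * (s ^ (2 * α - 1 - γ) - s ^ α) := by
    have e1 : s ^ γ = s ^ (γ - α) * s ^ α := by rw [← Real.rpow_add hs]; congr 1; ring
    have e2 : s ^ (α - 1) = s ^ (γ - α) * s ^ (2 * α - 1 - γ) := by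
      rw [← Real.rpow_add hs]; congr 1; ring
    have e3 : s ^ (2 * α - 1) = s ^ α * s ^ (α - 1) := by
      rw [← Real.rpow_add hs]; congr 1; ring
    rw [e3, e1, e2]; ring
  rw [e]
  refine mul_pos ?_ ?_
  · have := Real.rpow_lt_one hs.le hs1 (by linarith : 0 < γ - α)
    linarith
  · have := Real.rpow_lt_rpow_of_exponent_gt hs hs1 (by linarith : 2 * α - 1 - γ < α)
    linarith

/-- exact integral for the critical exponent -/
lemma crit_integral (α ε : ℝ) (h0 : 0 < α) (h1 : α < 1) (hε : 0 < ε) (hε1 : ε < 1) :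
    IntegrableOn (fun v : ℝ => (1 - (1 - v) ^ α) * ((1 - v) ^ (α - 1) - 1) * v ^ (-1 - 2 * α))
      (Set.Ioo ε 1) ∧
    1 / (2 * α) - ε ^ (2 - 2 * α) / (2 * α) ≤ ∫ v in Set.Ioo ε 1,
      (1 - (1 - v) ^ α) * ((1 - v) ^ (α - 1) - 1) * v ^ (-1 - 2 * α) := by
  set F : ℝ → ℝ := fun v => (1 - (1 - v) ^ α) ^ 2 * v ^ (-(2 * α)) / (2 * α) with hF
  have hcont : ContinuousOn F (Set.Icc ε 1) := by
    have c1 : Continuous fun v : ℝ => (1 - v) ^ α :=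
      (by fun_prop : Continuous fun v : ℝ => 1 - v).rpow_const fun _ => Or.inr h0.le
    have c2 : ContinuousOn (fun v : ℝ => v ^ (-(2 * α))) (Set.Icc ε 1) :=
      continuousOn_id.rpow_const fun v hv => Or.inl (by have := hv.1; simp only [id]; linarith)
    exact ((((continuous_const.sub c1).pow 2).continuousOn).mul c2).div_const _
  have hder : ∀ v ∈ Set.Ioo ε 1, HasDerivAt F
      ((1 - (1 - v) ^ α) * ((1 - v) ^ (α - 1) - 1) * v ^ (-1 - 2 * α)) v := by
    intro v hv
    have hv0 : 0 < v := hε.trans hv.1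
    have hs : 0 < 1 - v := by linarith [hv.2]
    have d1 : HasDerivAt (fun v : ℝ => (1 - v) ^ α) (-1 * α * (1 - v) ^ (α - 1)) v :=
      ((hasDerivAt_id v).const_sub 1).rpow_const (Or.inl hs.ne')
    have d2 : HasDerivAt (fun v : ℝ => v ^ (-(2 * α))) (-(2 * α) * v ^ (-(2 * α) - 1)) v :=
      Real.hasDerivAt_rpow_const (Or.inl hv0.ne')
    have d3 := (((d1.const_sub 1).pow 2).mul d2).div_const (2 * α)
    refine d3.congr_deriv ?_
    have e1 : v ^ (-(2 * α)) = v * v ^ (-1 - 2 * α) := by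
      rw [← Real.rpow_one_add' hv0.le (by intro h; linarith)]; congr 1; ring
    have e2 : (1 - v) ^ α = (1 - v) * (1 - v) ^ (α - 1) := by
      rw [← Real.rpow_one_add' hs.le (by intro h; linarith)]; congr 1; ring
    have e3 : v ^ (-(2 * α) - 1) = v ^ (-1 - 2 * α) := by congr 1; ring
    simp only [Pi.pow_apply]
    rw [e3, e1, e2]
    field_simp
    ring
  have hpos : ∀ v ∈ Set.Ioo ε 1,
      0 ≤ (1 - (1 - v) ^ α) * ((1 - v) ^ (α - 1) - 1) * v ^ (-1 - 2 * α) := by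
    intro v hv
    have hv0 : 0 < v := hε.trans hv.1
    have hs : 0 < 1 - v := by linarith [hv.2]
    have a1 : (1 - v) ^ α ≤ 1 := Real.rpow_le_one hs.le (by linarith) h0.le
    have a2 : 1 ≤ (1 - v) ^ (α - 1) :=
      Real.one_le_rpow_of_pos_of_le_one_of_nonpos hs (by linarith) (by linarith)
    exact mul_nonneg (mul_nonneg (by linarith) (by linarith)) (by positivity)
  have hint := intervalIntegral.integrableOn_deriv_of_nonneg hcont hder hpos
  refine ⟨hint.mono_set Set.Ioo_subset_Ioc_self, ?_⟩
  rw [← integral_Ioc_eq_integral_Ioo, ← intervalIntegral.integral_of_le hε1.le,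
    intervalIntegral.integral_eq_sub_of_hasDerivAt_of_le hε1.le hcont hder
      ((intervalIntegrable_iff_integrableOn_Ioc_of_le hε1.le).2 hint)]
  have hF1 : F 1 = 1 / (2 * α) := by simp [hF, Real.zero_rpow h0.ne']
  have hFe : F ε ≤ ε ^ (2 - 2 * α) / (2 * α) := by
    have b1 : (1 - ε) ^ α ≤ 1 := Real.rpow_le_one (by linarith) (by linarith) h0.le
    have b2 : 1 - ε ≤ (1 - ε) ^ α := by
      simpa using Real.rpow_le_rpow_of_exponent_ge (by linarith : 0 < 1 - ε) (by linarith) h1.le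
    have b3 : (1 - (1 - ε) ^ α) ^ 2 ≤ ε ^ 2 := by
      apply pow_le_pow_left₀ <;> linarith
    have b4 : ε ^ (2 - 2 * α) = ε ^ 2 * ε ^ (-(2 * α)) := by
      rw [← Real.rpow_two, ← Real.rpow_add hε]; congr 1
    simp only [hF]
    rw [b4]
    gcongr
  rw [hF1]; linarith

lemma subst_integral (γ α ε : ℝ) (h0 : 0 < γ) (h1 : γ < 1) (h2 : γ < 2 * α)
    (hε : 0 < ε) (hε1 : ε < 1) :
    IntegrableOn (fun r : ℝ => ((1 + r) ^ γ - 1) * r ^ (-1 - 2 * α)) (Set.Ioi ε) ∧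
    IntegrableOn (fun v : ℝ => ((1 - v) ^ (2 * α - 1 - γ) - (1 - v) ^ (2 * α - 1))
      * v ^ (-1 - 2 * α)) (Set.Ioo ε 1) ∧
    ∫ v in Set.Ioo ε 1, ((1 - v) ^ (2 * α - 1 - γ) - (1 - v) ^ (2 * α - 1)) * v ^ (-1 - 2 * α)
      ≤ ∫ r in Set.Ioi ε, ((1 + r) ^ γ - 1) * r ^ (-1 - 2 * α) := by
  have hnn : ∀ r ∈ Set.Ioi ε, 0 ≤ ((1 + r) ^ γ - 1) * r ^ (-1 - 2 * α) := by
    intro r hr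
    have hr0 : 0 < r := hε.trans hr
    have : 1 ≤ (1 + r) ^ γ := Real.one_le_rpow (by linarith) h0.le
    exact mul_nonneg (by linarith) (by positivity)
  have hI : IntegrableOn (fun r : ℝ => ((1 + r) ^ γ - 1) * r ^ (-1 - 2 * α)) (Set.Ioi ε) := by
    have hi : IntegrableOn (fun r : ℝ => r ^ (γ - 1 - 2 * α)) (Set.Ioi ε) :=
      integrableOn_Ioi_rpow_of_lt (by linarith) hε
    refine hi.mono' (by fun_prop : Measurable _).aestronglyMeasurable ?_
    refine (ae_restrict_iff' measurableSet_Ioi).2 (ae_of_all _ fun r hr => ?_)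
    have hr0 : 0 < r := hε.trans hr
    rw [Real.norm_of_nonneg (hnn r hr), show γ - 1 - 2 * α = γ + (-1 - 2 * α) by ring,
      Real.rpow_add hr0]
    have := Real.rpow_add_le_add_rpow zero_le_one hr0.le h0.le h1.le
    rw [Real.one_rpow] at this
    gcongr
    linarith
  have himg : (fun v : ℝ => v / (1 - v)) '' Set.Ioo ε 1 ⊆ Set.Ioi ε := by
    rintro _ ⟨v, hv, rfl⟩
    have hv0 : 0 < v := hε.trans hv.1
    have hs : 0 < 1 - v := by linarith [hv.2]
    refine lt_of_lt_of_le hv.1 ?_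
    simp only
    rw [le_div_iff₀ hs]
    nlinarith
  have hder : ∀ v ∈ Set.Ioo ε 1,
      HasDerivWithinAt (fun v : ℝ => v / (1 - v)) (1 / (1 - v) ^ 2) (Set.Ioo ε 1) v := by
    intro v hv
    have hs : 0 < 1 - v := by linarith [hv.2]
    have := (hasDerivAt_id v).div ((hasDerivAt_id v).const_sub 1) hs.ne'
    refine (this.congr_deriv ?_).hasDerivWithinAt
    simp
  have hinj : Set.InjOn (fun v : ℝ => v / (1 - v)) (Set.Ioo ε 1) := by
    intro a ha b hb hab
    have h1 : 1 - a ≠ 0 := by linarith [ha.2]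
    have h2 : 1 - b ≠ 0 := by linarith [hb.2]
    simp only at hab
    rw [div_eq_div_iff h1 h2] at hab
    linarith
  have heq : Set.EqOn
      (fun v : ℝ => |1 / (1 - v) ^ 2| • (((1 + v / (1 - v)) ^ γ - 1) * (v / (1 - v)) ^ (-1 - 2 * α)))
      (fun v : ℝ => ((1 - v) ^ (2 * α - 1 - γ) - (1 - v) ^ (2 * α - 1)) * v ^ (-1 - 2 * α))
      (Set.Ioo ε 1) := by
    intro v hv
    have hv0 : 0 < v := hε.trans hv.1
    have hs : 0 < 1 - v := by linarith [hv.2]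
    have e1 : 1 + v / (1 - v) = (1 - v)⁻¹ := by field_simp; ring
    simp only [smul_eq_mul]
    rw [e1, abs_of_pos (by positivity), Real.div_rpow hv0.le hs.le, Real.inv_rpow hs.le,
      ← Real.rpow_neg hs.le]
    have e2 : (1 - v) ^ (2 * α - 1 - γ) = (1 - v) ^ (2 * α - 1) * (1 - v) ^ (-γ) := by
      rw [← Real.rpow_add hs]; congr 1
    have e3 : (1 - v) ^ (2 * α - 1) * ((1 - v) ^ 2 * (1 - v) ^ (-1 - 2 * α)) = 1 := by
      rw [← Real.rpow_two, ← Real.rpow_add hs, ← Real.rpow_add hs]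
      ring_nf; simp
    have e4 : (1 - v) ^ (2 * α - 1) = 1 / ((1 - v) ^ 2 * (1 - v) ^ (-1 - 2 * α)) := by
      rw [eq_div_iff (by positivity)]; exact e3
    rw [e2, e4]
    field_simp
  refine ⟨hI, ?_, ?_⟩
  · have := (integrableOn_image_iff_integrableOn_abs_deriv_smul measurableSet_Ioo hder hinj
      (fun r : ℝ => ((1 + r) ^ γ - 1) * r ^ (-1 - 2 * α))).1 (hI.mono_set himg)
    exact this.congr_fun heq measurableSet_Ioo
  · rw [← setIntegral_congr_fun measurableSet_Ioo heq,
      ← integral_image_eq_integral_abs_deriv_smul measurableSet_Ioo hder hinj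
        (fun r : ℝ => ((1 + r) ^ γ - 1) * r ^ (-1 - 2 * α))]
    exact setIntegral_mono_set hI
      ((ae_restrict_iff' measurableSet_Ioi).2 (ae_of_all _ hnn)) himg.eventuallyLE

lemma oneD_pos (γ α : ℝ) (hα0 : 0 < α) (hαγ : α < γ) (h1 : γ < 1) (h2 : γ < 2 * α) :
    0 < ∫ r in Set.Ioi (0:ℝ), hG γ r * r ^ (-1 - 2 * α) := by
  have h0 : 0 < γ := hα0.trans hαγ
  have hα1 : α < 1 := hαγ.trans h1
  have hA : ∀ ε : ℝ, 0 < ε →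
      IntegrableOn (fun v : ℝ => ((1 - v) ^ γ - 1) * v ^ (-1 - 2 * α)) (Set.Ioo ε 1) := by
    intro ε hε
    have hi : IntegrableOn (fun r : ℝ => r ^ (-1 - 2 * α)) (Set.Ioo ε 1) :=
      (integrableOn_Ioi_rpow_of_lt (by linarith) hε).mono_set Set.Ioo_subset_Ioi_self
    refine hi.mono' (by fun_prop : Measurable _).aestronglyMeasurable ?_
    refine (ae_restrict_iff' measurableSet_Ioo).2 (ae_of_all _ fun r hr => ?_)
    have hr0 : 0 < r := hε.trans hr.1
    have a1 : (1 - r) ^ γ ≤ 1 := Real.rpow_le_one (by linarith [hr.2]) (by linarith) h0.le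
    have a2 : 0 ≤ (1 - r) ^ γ := Real.rpow_nonneg (by linarith [hr.2]) _
    have a3 : 0 < r ^ (-1 - 2 * α) := by positivity
    rw [norm_mul, Real.norm_eq_abs, Real.norm_of_nonneg a3.le]
    have : |(1 - r) ^ γ - 1| ≤ 1 := by rw [abs_le]; constructor <;> linarith
    nlinarith
  have hDeq : ∀ v : ℝ, hD γ α v = ((1 - v) ^ γ - 1) * v ^ (-1 - 2 * α)
      + ((1 - v) ^ (2 * α - 1 - γ) - (1 - v) ^ (2 * α - 1)) * v ^ (-1 - 2 * α)
      - (1 - (1 - v) ^ α) * ((1 - v) ^ (α - 1) - 1) * v ^ (-1 - 2 * α) := by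
    intro v; unfold hD; ring
  have hDi : ∀ ε : ℝ, 0 < ε → ε < 1 → IntegrableOn (hD γ α) (Set.Ioo ε 1) := by
    intro ε hε hε1
    have := ((hA ε hε).add (subst_integral γ α ε h0 h1 h2 hε hε1).2.1).sub
      (crit_integral α ε hα0 hα1 hε hε1).1
    exact this.congr (ae_of_all _ fun v => (hDeq v).symm)
  set c0 := ∫ v in Set.Ioo (1/2 : ℝ) 1, hD γ α v with hc0
  have hc0pos : 0 < c0 := by
    rw [hc0, setIntegral_pos_iff_support_of_nonneg_ae]
    · have : Set.Ioo (1/2:ℝ) 1 ⊆ Function.support (hD γ α) ∩ Set.Ioo (1/2) 1 := fun v hv =>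
        ⟨(hD_pos γ α v hαγ (by linarith [hv.1]) hv.2).ne', hv⟩
      refine lt_of_lt_of_le ?_ (measure_mono this)
      rw [Real.volume_Ioo]; norm_num
    · exact (ae_restrict_iff' measurableSet_Ioo).2 (ae_of_all _ fun v hv =>
        (hD_pos γ α v hαγ (by linarith [hv.1]) hv.2).le)
    · exact hDi _ (by norm_num) (by norm_num)
  have hGi := hG_oneD_integrable γ α h0 h1 h2 hα1
  -- the key estimate
  have key : ∀ ε : ℝ, 0 < ε → ε < 1/2 →
      c0 - ε ^ (2 - 2 * α) * (1 / (2 * α) + 1 / (1 - α)) ≤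
        ∫ r in Set.Ioi (0:ℝ), hG γ r * r ^ (-1 - 2 * α) := by
    intro ε hε hε2
    have hε1 : ε < 1 := by linarith
    obtain ⟨s1, s2, s3⟩ := subst_integral γ α ε h0 h1 h2 hε hε1
    obtain ⟨k1, k2⟩ := crit_integral α ε hα0 hα1 hε hε1
    have hGi0 : IntegrableOn (fun r : ℝ => hG γ r * r ^ (-1 - 2 * α)) (Set.Ioc 0 ε) :=
      hGi.mono_set fun r hr => hr.1
    have hGi1 : IntegrableOn (fun r : ℝ => hG γ r * r ^ (-1 - 2 * α)) (Set.Ioi ε) :=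
      hGi.mono_set fun r hr => hε.trans hr
    rw [← Set.Ioc_union_Ioi_eq_Ioi hε.le, setIntegral_union
      (Set.Ioc_disjoint_Ioi le_rfl) measurableSet_Ioi hGi0 hGi1]
    -- inner part
    have p1 : - (ε ^ (2 - 2 * α) * (1 / (1 - α))) ≤
        ∫ r in Set.Ioc 0 ε, hG γ r * r ^ (-1 - 2 * α) := by
      have hi : IntegrableOn (fun r : ℝ => -2 * r ^ (1 - 2 * α)) (Set.Ioc 0 ε) := by
        refine Integrable.const_mul ?_ _
        rw [← IntegrableOn, integrableOn_Ioc_iff_integrableOn_Ioo,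
          intervalIntegral.integrableOn_Ioo_rpow_iff hε]
        linarith
      have hmono := setIntegral_mono_on hi hGi0 measurableSet_Ioc (fun r hr => by
        have hr0 : 0 < r := hr.1
        have := hG_small_lower γ r h0 h1 hr0.le (by linarith [hr.2])
        have e : r ^ (1 - 2 * α) = r ^ 2 * r ^ (-1 - 2 * α) := by
          rw [← Real.rpow_two, ← Real.rpow_add hr0]; congr 1; ring
        rw [e, ← mul_assoc]
        exact mul_le_mul_of_nonneg_right this (by positivity))
      refine le_trans (le_of_eq ?_) hmono
      rw [integral_const_mul, ← intervalIntegral.integral_of_le hε.le,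
        integral_rpow (Or.inl (by linarith)), Real.zero_rpow (by linarith),
        show (1 - 2 * α + 1) = 2 - 2 * α by ring]
      have : 1 - α ≠ 0 := by linarith
      have : 2 - 2 * α ≠ 0 := by linarith
      field_simp
      ring
    -- outer part
    have hT : IntegrableOn (fun r : ℝ => r ^ (-1 - 2 * α)) (Set.Ioi 1) :=
      integrableOn_Ioi_rpow_of_lt (by linarith) one_pos
    have hT2 : ∫ r in Set.Ioi (1:ℝ), r ^ (-1 - 2 * α) = 1 / (2 * α) := by
      rw [integral_Ioi_rpow_of_lt (by linarith) one_pos, Real.one_rpow]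
      rw [show -1 - 2 * α + 1 = -(2 * α) by ring]
      rw [neg_div_neg_eq]
    set g2 : ℝ → ℝ := fun r => ((max (1 - r) 0) ^ γ - 1) * r ^ (-1 - 2 * α) with hg2
    have q1 : Set.EqOn (fun v : ℝ => ((1 - v) ^ γ - 1) * v ^ (-1 - 2 * α)) g2 (Set.Ioo ε 1) := by
      intro v hv
      simp only [hg2]
      rw [max_eq_left (by linarith [hv.2])]
    have q2 : Set.EqOn (fun v : ℝ => - v ^ (-1 - 2 * α)) g2 (Set.Ici 1) := by
      intro v hv
      have : (1:ℝ) ≤ v := hv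
      simp only [hg2]
      rw [max_eq_right (by linarith), Real.zero_rpow h0.ne']
      ring
    have g2i1 : IntegrableOn g2 (Set.Ioo ε 1) := (hA ε hε).congr_fun q1 measurableSet_Ioo
    have g2i2 : IntegrableOn g2 (Set.Ici 1) := by
      refine IntegrableOn.congr_fun ?_ q2 measurableSet_Ici
      rw [integrableOn_Ici_iff_integrableOn_Ioi]
      exact hT.neg
    have g2i : IntegrableOn g2 (Set.Ioi ε) := by
      rw [← Set.Ioo_union_Ici_eq_Ioi hε1]; exact g2i1.union g2i2
    have g2e : ∫ r in Set.Ioi ε, g2 r =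
        (∫ v in Set.Ioo ε 1, ((1 - v) ^ γ - 1) * v ^ (-1 - 2 * α)) - 1 / (2 * α) := by
      have hdisj : Disjoint (Set.Ioo ε 1) (Set.Ici 1) :=
        Set.disjoint_left.2 fun v hv hv' => absurd hv.2 (not_lt.2 hv')
      rw [← Set.Ioo_union_Ici_eq_Ioi hε1, setIntegral_union hdisj measurableSet_Ici g2i1 g2i2,
        ← setIntegral_congr_fun measurableSet_Ioo q1, ← setIntegral_congr_fun measurableSet_Ici q2,
        integral_neg, integral_Ici_eq_integral_Ioi, hT2]
      ring
    have p2 : ∫ r in Set.Ioi ε, hG γ r * r ^ (-1 - 2 * α) =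
        (∫ r in Set.Ioi ε, ((1 + r) ^ γ - 1) * r ^ (-1 - 2 * α)) + ∫ r in Set.Ioi ε, g2 r := by
      rw [← integral_add s1 g2i]
      refine setIntegral_congr_fun measurableSet_Ioi fun r hr => ?_
      have hr0 : 0 < r := hε.trans hr
      simp only [hg2, hG]
      rw [max_eq_left (by linarith : 0 ≤ 1 + r)]
      ring
    have p3 : ∫ v in Set.Ioo ε 1, hD γ α v =
        (∫ v in Set.Ioo ε 1, ((1 - v) ^ γ - 1) * v ^ (-1 - 2 * α))
        + (∫ v in Set.Ioo ε 1, ((1 - v) ^ (2 * α - 1 - γ) - (1 - v) ^ (2 * α - 1))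
            * v ^ (-1 - 2 * α))
        - ∫ v in Set.Ioo ε 1, (1 - (1 - v) ^ α) * ((1 - v) ^ (α - 1) - 1) * v ^ (-1 - 2 * α) := by
      rw [← integral_add (hA ε hε) s2]
      refine Eq.trans ?_ (integral_sub ((hA ε hε).add s2) k1)
      exact integral_congr_ae (ae_of_all _ fun v => hDeq v)
    have p4 : c0 ≤ ∫ v in Set.Ioo ε 1, hD γ α v := by
      refine setIntegral_mono_set (hDi ε hε hε1) ?_
        (Set.Ioo_subset_Ioo_left hε2.le).eventuallyLE
      exact (ae_restrict_iff' measurableSet_Ioo).2 (ae_of_all _ fun v hv =>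
        (hD_pos γ α v hαγ (by linarith [hv.1]) hv.2).le)
    rw [p2, g2e]
    have : ε ^ (2 - 2 * α) / (2 * α) = ε ^ (2 - 2 * α) * (1 / (2 * α)) := by ring
    linarith
  refine lt_of_lt_of_le hc0pos ?_
  have hlim : Filter.Tendsto (fun ε : ℝ => c0 - ε ^ (2 - 2 * α) * (1 / (2 * α) + 1 / (1 - α)))
      (nhdsWithin 0 (Set.Ioi 0)) (nhds c0) := by
    have hc : Continuous fun ε : ℝ => c0 - ε ^ (2 - 2 * α) * (1 / (2 * α) + 1 / (1 - α)) := by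
      have : Continuous fun ε : ℝ => ε ^ (2 - 2 * α) :=
        continuous_id.rpow_const fun _ => Or.inr (by linarith)
      fun_prop
    have := (hc.tendsto 0).mono_left (nhdsWithin_le_nhds (s := Set.Ioi 0))
    simpa [Real.zero_rpow (by linarith : 2 - 2 * α ≠ 0)] using this
  refine le_of_tendsto hlim ?_
  filter_upwards [Ioo_mem_nhdsGT (by norm_num : (0:ℝ) < 1/2)] with ε hε
  exact key ε hε.1 hε.2

lemma inner_oneD (γ α c : ℝ) (h0 : 0 < α) :
    ∫ r in Set.Ioi (0:ℝ), hG γ (r * c) * r ^ (-1 - 2 * α) =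
      |c| ^ (2 * α) * ∫ r in Set.Ioi (0:ℝ), hG γ r * r ^ (-1 - 2 * α) := by
  rcases eq_or_ne c 0 with rfl | hc
  · have : hG γ 0 = 0 := by simp [hG]; norm_num
    simp only [mul_zero, this, zero_mul, abs_zero]
    rw [Real.zero_rpow (by linarith)]
    simp
  have hc' : 0 < |c| := abs_pos.2 hc
  have h := integral_comp_mul_left_Ioi' (fun r => hG γ r * r ^ (-1 - 2 * α)) 0 hc'
  rw [mul_zero] at h
  have e : Set.EqOn (fun r : ℝ => hG γ (|c| * r) * (|c| * r) ^ (-1 - 2 * α))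
      (fun r : ℝ => |c| ^ (-1 - 2 * α) * (hG γ (r * c) * r ^ (-1 - 2 * α))) (Set.Ioi 0) := by
    intro r hr
    have hr0 : 0 < r := hr
    simp only
    rw [Real.mul_rpow hc'.le hr0.le, ← hG_abs' γ (r * c), abs_mul, abs_of_pos hr0, mul_comm r]
    ring
  rw [setIntegral_congr_fun measurableSet_Ioi e, integral_const_mul, smul_eq_mul,
    ← mul_assoc] at h
  rw [← h, ← mul_assoc]
  have : |c| ^ (2 * α) * (|c| * |c| ^ (-1 - 2 * α)) = 1 := by
    rw [← Real.rpow_one_add' hc'.le (by intro h; linarith), ← Real.rpow_add hc']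
    ring_nf; simp
  rw [this, one_mul]

lemma nD_pos (N : ℕ) (hN : 2 ≤ N) (γ α : ℝ) (hα0 : 0 < α) (hαγ : α < γ) (h1 : γ < 1)
    (h2 : γ < 2 * α) (e : EuclideanSpace ℝ (Fin N)) (he : ‖e‖ = 1) :
    0 < ∫ y : EuclideanSpace ℝ (Fin N), hG γ (inner ℝ y e) * ‖y‖ ^ (-((N : ℝ) + 2 * α)) := by
  have h0 : 0 < γ := hα0.trans hαγ
  have hα1 : α < 1 := hαγ.trans h1
  have : Nonempty (Fin N) := ⟨⟨0, by omega⟩⟩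
  have : Nontrivial (EuclideanSpace ℝ (Fin N)) := by infer_instance
  set F : EuclideanSpace ℝ (Fin N) → ℝ := fun y =>
    hG γ (inner ℝ y e) * ‖y‖ ^ (-((N : ℝ) + 2 * α)) with hF
  have hFi : Integrable F := hG_nD_integrable N hN γ α h0 h1 h2 hα1 e he
  set μ : Measure (EuclideanSpace ℝ (Fin N)) := volume with hμ
  let g : Metric.sphere (0 : EuclideanSpace ℝ (Fin N)) 1 × Set.Ioi (0:ℝ) → ℝ :=
    fun p => F (p.2.1 • p.1.1)
  have hg : ∀ x : ({0}ᶜ : Set (EuclideanSpace ℝ (Fin N))),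
      g (homeomorphUnitSphereProd _ x) = F x.1 := by
    intro x
    have hx : ‖x.1‖ ≠ 0 := norm_ne_zero_iff.2 x.2
    simp only [g, homeomorphUnitSphereProd_apply_fst_coe, homeomorphUnitSphereProd_apply_snd_coe]
    rw [smul_smul, mul_inv_cancel₀ hx, one_smul]
  have hmp := μ.measurePreserving_homeomorphUnitSphereProd
  have hgi : Integrable g (μ.toSphere.prod
      (.volumeIoiPow (Module.finrank ℝ (EuclideanSpace ℝ (Fin N)) - 1))) := by
    rw [← hmp.integrable_comp_emb (Homeomorph.measurableEmbedding _)]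
    have : g ∘ (homeomorphUnitSphereProd (EuclideanSpace ℝ (Fin N))) = F ∘ Subtype.val := by
      funext x; exact hg x
    rw [this, ← integrableOn_iff_comap_subtypeVal (measurableSet_singleton _).compl]
    exact hFi.integrableOn
  have e1 : ∫ y, F y ∂μ = ∫ p, g p ∂(μ.toSphere.prod
      (.volumeIoiPow (Module.finrank ℝ (EuclideanSpace ℝ (Fin N)) - 1))) := by
    rw [← hmp.integral_comp (Homeomorph.measurableEmbedding _)]
    simp only [hg]
    rw [integral_subtype_comap (measurableSet_singleton _).compl fun x ↦ F x,
        restrict_compl_singleton]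
  have e2 : ∀ θ : Metric.sphere (0 : EuclideanSpace ℝ (Fin N)) 1,
      ∫ r, g (θ, r) ∂(Measure.volumeIoiPow (Module.finrank ℝ (EuclideanSpace ℝ (Fin N)) - 1)) =
      |inner ℝ θ.1 e| ^ (2 * α) * ∫ r in Set.Ioi (0:ℝ), hG γ r * r ^ (-1 - 2 * α) := by
    intro θ
    have hθ : ‖θ.1‖ = 1 := by simpa using θ.2
    rw [← inner_oneD γ α _ hα0]
    simp only [Measure.volumeIoiPow, ENNReal.ofReal]
    rw [integral_withDensity_eq_integral_smul,
      integral_subtype_comap measurableSet_Ioi fun a ↦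
        Real.toNNReal (a ^ (Module.finrank ℝ (EuclideanSpace ℝ (Fin N)) - 1)) • F (a • θ.1),
      setIntegral_congr_fun measurableSet_Ioi fun r hr ↦ ?_]
    · have hr0 : (0:ℝ) < r := hr
      simp only [hF]
      rw [NNReal.smul_def, Real.coe_toNNReal _ (pow_nonneg hr0.le _), norm_smul, hθ, mul_one,
        Real.norm_of_nonneg hr0.le, real_inner_smul_left, smul_eq_mul, mul_left_comm]
      congr 1
      simp only [finrank_euclideanSpace, Fintype.card_fin]
      rw [← Real.rpow_natCast, ← Real.rpow_add hr0]
      congr 1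
      push_cast [Nat.cast_sub (by omega : 1 ≤ N)]
      ring
    · exact (measurable_subtype_coe.pow_const _).real_toNNReal
  rw [e1, integral_prod _ hgi]
  simp only [e2]
  rw [integral_mul_const]
  refine mul_pos ?_ (oneD_pos γ α hα0 hαγ h1 h2)
  have hc : Continuous fun θ : Metric.sphere (0 : EuclideanSpace ℝ (Fin N)) 1 =>
      |inner ℝ θ.1 e| ^ (2 * α) :=
    (by fun_prop : Continuous fun θ : Metric.sphere (0 : EuclideanSpace ℝ (Fin N)) 1 =>
      |inner ℝ θ.1 e|).rpow_const fun _ => Or.inr (by linarith)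
  refine hc.integral_pos_of_hasCompactSupport_nonneg_nonzero
    (HasCompactSupport.of_compactSpace _) (fun θ => by positivity)
    (x := ⟨e, by simpa using he⟩) ?_
  simp [he]

lemma nD_rot (N : ℕ) (γ α : ℝ) (e e' : EuclideanSpace ℝ (Fin N)) (he : ‖e‖ = ‖e'‖) :
    ∫ y : EuclideanSpace ℝ (Fin N), hG γ (inner ℝ y e) * ‖y‖ ^ (-((N : ℝ) + 2 * α)) =
    ∫ y : EuclideanSpace ℝ (Fin N), hG γ (inner ℝ y e') * ‖y‖ ^ (-((N : ℝ) + 2 * α)) := by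
  set R := (Submodule.span ℝ {e - e'})ᗮ.reflection with hR
  have hRe : R e = e' := Submodule.reflection_sub he
  rw [← R.measurePreserving.integral_comp R.toHomeomorph.measurableEmbedding
    (fun y => hG γ (inner ℝ y e') * ‖y‖ ^ (-((N : ℝ) + 2 * α)))]
  refine integral_congr_ae (ae_of_all _ fun y => ?_)
  simp only
  rw [← hRe, R.inner_map_map, R.norm_map]

lemma nD_scale (N : ℕ) (hN : 2 ≤ N) (γ α : ℝ) (h0 : 0 < γ) (h1 : γ < 1)
    (h2 : γ < 2 * α) (hα : α < 1) (e : EuclideanSpace ℝ (Fin N)) (he : ‖e‖ = 1)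
    (l : ℝ) (hl : 0 < l) :
    Integrable (fun y : EuclideanSpace ℝ (Fin N) =>
      hG γ (l * inner ℝ y e) * ‖y‖ ^ (-((N : ℝ) + 2 * α))) ∧
    ∫ y : EuclideanSpace ℝ (Fin N), hG γ (l * inner ℝ y e) * ‖y‖ ^ (-((N : ℝ) + 2 * α)) =
      l ^ (2 * α) *
      ∫ y : EuclideanSpace ℝ (Fin N), hG γ (inner ℝ y e) * ‖y‖ ^ (-((N : ℝ) + 2 * α)) := by
  have hi := hG_nD_integrable N hN γ α h0 h1 h2 hα e he
  set F : EuclideanSpace ℝ (Fin N) → ℝ := fun y =>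
    hG γ (inner ℝ y e) * ‖y‖ ^ (-((N : ℝ) + 2 * α)) with hF
  have heq : (fun y : EuclideanSpace ℝ (Fin N) =>
      hG γ (l * inner ℝ y e) * ‖y‖ ^ (-((N : ℝ) + 2 * α))) =
      fun y => l ^ ((N:ℝ) + 2 * α) * F (l • y) := by
    funext y
    simp only [hF]
    rw [real_inner_smul_left, norm_smul, Real.norm_of_nonneg hl.le,
      Real.mul_rpow hl.le (norm_nonneg _), Real.rpow_neg hl.le]
    have : 0 < l ^ ((N:ℝ) + 2 * α) := by positivity
    field_simp
  rw [heq]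
  refine ⟨((integrable_comp_smul_iff volume F hl.ne').2 hi).const_mul _, ?_⟩
  rw [integral_const_mul, Measure.integral_comp_smul, smul_eq_mul, ← mul_assoc]
  congr 1
  simp only [finrank_euclideanSpace, Fintype.card_fin]
  rw [abs_of_pos (by positivity), Real.rpow_add hl, Real.rpow_natCast]
  field_simp

lemma max_sub_rpow (γ a b : ℝ) (h0 : 0 < γ) (h1 : γ < 1) (hb : 0 ≤ b) :
    (max a 0) ^ γ - b ^ γ ≤ (max (a - b) 0) ^ γ := by
  have h3 : max a 0 ≤ max (a - b) 0 + b := by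
    apply max_le
    · linarith [le_max_left (a - b) 0]
    · linarith [le_max_right (a - b) 0]
  have h4 := Real.rpow_le_rpow (le_max_right _ _) h3 h0.le
  have h5 := Real.rpow_add_le_add_rpow (le_max_right (a - b) 0) hb h0.le h1.le
  linarith

lemma barrier_lower (N : ℕ) (γ : ℝ) (h0 : 0 < γ) (h1 : γ < 1)
    (p x y : EuclideanSpace ℝ (Fin N)) (hx : ‖x - p‖ < 1) (hx0 : 0 < ‖x - p‖) :
    (1 - ‖x - p‖ ^ 2) ^ γ *
      hG γ ((2 * ‖x - p‖ / (1 - ‖x - p‖ ^ 2)) * inner ℝ y ((‖x - p‖)⁻¹ • (x - p)))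
      - 4 * min (‖y‖ ^ (2 * γ)) (‖y‖ ^ γ) ≤
    nlD (fun w => (max (1 - ‖w - p‖ ^ 2) 0) ^ γ) x y := by
  have e1 : x + y - p = (x - p) + y := by abel
  have e2 : x - y - p = (x - p) - y := by abel
  simp only [nlD]
  rw [e1, e2]
  generalize x - p = z at *
  have hd : 0 < 1 - ‖z‖ ^ 2 := by nlinarith
  have n1 : 1 - ‖z + y‖ ^ 2 = ((1 - ‖z‖ ^ 2) - 2 * inner ℝ y z) - ‖y‖ ^ 2 := by
    rw [norm_add_sq_real, real_inner_comm]; ring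
  have n2 : 1 - ‖z - y‖ ^ 2 = ((1 - ‖z‖ ^ 2) + 2 * inner ℝ y z) - ‖y‖ ^ 2 := by
    rw [norm_sub_sq_real, real_inner_comm]; ring
  have hs : (2 * ‖z‖ / (1 - ‖z‖ ^ 2)) * inner ℝ y ((‖z‖)⁻¹ • z) =
      2 * inner ℝ y z / (1 - ‖z‖ ^ 2) := by
    rw [real_inner_smul_right]; field_simp
  rw [hs, n1, n2, max_eq_left hd.le]
  have hd1 : 1 - ‖z‖ ^ 2 ≤ 1 := by nlinarith [sq_nonneg ‖z‖]
  have hin : |2 * inner ℝ y z| ≤ 2 * ‖y‖ := by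
    rw [abs_mul, abs_two]
    have := abs_real_inner_le_norm y z
    have := norm_nonneg y
    nlinarith
  generalize 1 - ‖z‖ ^ 2 = d at *
  generalize 2 * inner ℝ y z = t at *
  have hy := norm_nonneg y
  generalize ‖y‖ = r at *
  have hdγ : 0 < d ^ γ := by positivity
  have hGd : d ^ γ * hG γ (t / d) = (max (d + t) 0) ^ γ + (max (d - t) 0) ^ γ - 2 * d ^ γ := by
    have m1 : max (d + t) 0 = d * max (1 + t / d) 0 := by
      rw [mul_max_of_nonneg _ _ hd.le, mul_zero]; congr 1; field_simp
    have m2 : max (d - t) 0 = d * max (1 - t / d) 0 := by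
      rw [mul_max_of_nonneg _ _ hd.le, mul_zero]; congr 1; field_simp
    rw [m1, m2, Real.mul_rpow hd.le (le_max_right _ _), Real.mul_rpow hd.le (le_max_right _ _)]
    unfold hG; ring
  rcases le_total r 1 with hr | hr
  · have hmin : r ^ (2 * γ) ≤ r ^ γ := by
      rcases hy.eq_or_lt with h | h
      · rw [← h, Real.zero_rpow h0.ne', Real.zero_rpow (by linarith)]
      · exact Real.rpow_le_rpow_of_exponent_ge h hr (by linarith)
    rw [min_eq_left hmin, hGd]
    have a1 := max_sub_rpow γ (d + t) (r ^ 2) h0 h1 (by positivity)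
    have a2 := max_sub_rpow γ (d - t) (r ^ 2) h0 h1 (by positivity)
    have a3 : (r ^ 2) ^ γ = r ^ (2 * γ) := by rw [← Real.rpow_two, ← Real.rpow_mul hy]
    rw [a3] at a1 a2
    have : 0 ≤ r ^ (2 * γ) := by positivity
    linarith
  · have hmin : r ^ γ ≤ r ^ (2 * γ) := Real.rpow_le_rpow_of_exponent_le hr (by linarith)
    rw [min_eq_right hmin]
    have b1 : d ^ γ * hG γ (t / d) ≤ 2 * r ^ γ := by
      calc d ^ γ * hG γ (t / d) ≤ d ^ γ * |t / d| ^ γ := by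
            gcongr; exact hG_upper γ _ h0 h1
        _ = |t| ^ γ := by
            rw [← Real.mul_rpow hd.le (abs_nonneg _), abs_div, abs_of_pos hd]
            congr 1; field_simp
        _ ≤ (2 * r) ^ γ := by gcongr
        _ = 2 ^ γ * r ^ γ := Real.mul_rpow (by norm_num) hy
        _ ≤ 2 * r ^ γ := by
            gcongr
            simpa using Real.rpow_le_rpow_of_exponent_le (by norm_num : (1:ℝ) ≤ 2) h1.le
    have b2 : d ^ γ ≤ 1 := Real.rpow_le_one hd.le hd1 h0.le
    have b3 : 1 ≤ r ^ γ := Real.one_le_rpow hr h0.le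
    have b4 : 0 ≤ (max (d - t - r ^ 2) 0) ^ γ := by positivity
    have b5 : 0 ≤ (max (d + t - r ^ 2) 0) ^ γ := by positivity
    linarith

/-- Near the unit sphere the barrier is a strict subsolution, with an integrable minorant. -/
lemma barrier_sub (N : ℕ) (hN : 2 ≤ N) (γ α : ℝ) (hα0 : 0 < α) (hαγ : α < γ) (h1 : γ < 1)
    (h2 : γ < 2 * α) (p : EuclideanSpace ℝ (Fin N)) :
    ∃ ρ : ℝ, 0 < ρ ∧ ρ < 1 ∧ ∀ x, ‖x - p‖ < 1 → ρ < ‖x - p‖ →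
      ∃ L : EuclideanSpace ℝ (Fin N) → ℝ,
        (∀ y, L y ≤ nlD (fun w => (max (1 - ‖w - p‖ ^ 2) 0) ^ γ) x y) ∧
        Integrable (fun y => L y * ‖y‖ ^ (-((N : ℝ) + 2 * α))) ∧
        0 < ∫ y, L y * ‖y‖ ^ (-((N : ℝ) + 2 * α)) := by
  have h0 : 0 < γ := hα0.trans hαγ
  have hα1 : α < 1 := hαγ.trans h1
  let e0 : EuclideanSpace ℝ (Fin N) := EuclideanSpace.single ⟨0, by omega⟩ 1
  have he0 : ‖e0‖ = 1 := by simp [e0]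
  set A := ∫ y : EuclideanSpace ℝ (Fin N), hG γ (inner ℝ y e0) * ‖y‖ ^ (-((N : ℝ) + 2 * α))
    with hA
  have hApos : 0 < A := nD_pos N hN γ α hα0 hαγ h1 h2 e0 he0
  have hMi := nD_min_integrable N hN (2 * γ) γ α h2 (by linarith)
  set B := ∫ y : EuclideanSpace ℝ (Fin N),
    min (‖y‖ ^ (2 * γ)) (‖y‖ ^ γ) * ‖y‖ ^ (-((N : ℝ) + 2 * α)) with hB
  have hlim := (tendsto_rpow_neg_nhdsGT_zero (y := γ - 2 * α) (by linarith)).eventually_gt_atTop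
    (4 * B / A)
  obtain ⟨η, hη0, hη⟩ := (mem_nhdsGT_iff_exists_Ioo_subset).1 hlim
  have hη0 : (0:ℝ) < η := hη0
  set η' := min η (3/4) with hη'
  have hη'0 : 0 < η' := lt_min hη0 (by norm_num)
  have hη'1 : η' ≤ 3/4 := min_le_right _ _
  refine ⟨Real.sqrt (1 - η'), Real.sqrt_pos.2 (by linarith), ?_, ?_⟩
  · rw [Real.sqrt_lt' one_pos]; linarith
  intro x hx hxρ
  have hsq : 1 - η' < ‖x - p‖ ^ 2 := (Real.sqrt_lt' ((Real.sqrt_nonneg _).trans_lt hxρ)).1 hxρ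
  have hz : 1/2 ≤ ‖x - p‖ := by
    by_contra h
    push Not at h
    nlinarith [norm_nonneg (x - p)]
  have hx0 : 0 < ‖x - p‖ := by linarith
  have hd0 : 0 < 1 - ‖x - p‖ ^ 2 := by nlinarith
  have hdη : 1 - ‖x - p‖ ^ 2 < η := by
    have := min_le_left η (3/4 : ℝ)
    linarith
  have hbig : 4 * B / A < (1 - ‖x - p‖ ^ 2) ^ (γ - 2 * α) := hη ⟨hd0, hdη⟩
  rw [div_lt_iff₀ hApos] at hbig
  set d := 1 - ‖x - p‖ ^ 2 with hd
  set l := 2 * ‖x - p‖ / d with hl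
  set e := (‖x - p‖)⁻¹ • (x - p) with he
  have hl0 : 0 < l := by positivity
  have hen : ‖e‖ = 1 := by
    rw [he, norm_smul, norm_inv, norm_norm, inv_mul_cancel₀ hx0.ne']
  obtain ⟨si, se⟩ := nD_scale N hN γ α h0 h1 h2 hα1 e hen l hl0
  rw [nD_rot N γ α e e0 (by rw [hen, he0]), ← hA] at se
  have hLeq : (fun y : EuclideanSpace ℝ (Fin N) =>
      (d ^ γ * hG γ (l * inner ℝ y e) - 4 * min (‖y‖ ^ (2 * γ)) (‖y‖ ^ γ))
        * ‖y‖ ^ (-((N : ℝ) + 2 * α))) =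
      fun y => d ^ γ * (hG γ (l * inner ℝ y e) * ‖y‖ ^ (-((N : ℝ) + 2 * α))) -
        4 * (min (‖y‖ ^ (2 * γ)) (‖y‖ ^ γ) * ‖y‖ ^ (-((N : ℝ) + 2 * α))) := by
    funext y; ring
  refine ⟨fun y => d ^ γ * hG γ (l * inner ℝ y e) - 4 * min (‖y‖ ^ (2 * γ)) (‖y‖ ^ γ),
    fun y => barrier_lower N γ h0 h1 p x y hx hx0, ?_, ?_⟩
  · rw [hLeq]
    exact (si.const_mul _).sub (hMi.const_mul _)
  · rw [hLeq, integral_sub (si.const_mul _) (hMi.const_mul _), integral_const_mul,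
      integral_const_mul, se, ← hB]
    have hle : d ^ (γ - 2 * α) ≤ d ^ γ * l ^ (2 * α) := by
      have h3 : d⁻¹ ≤ l := by
        rw [hl, inv_eq_one_div]; gcongr; linarith
      have h4 : (d⁻¹) ^ (2 * α) ≤ l ^ (2 * α) := by gcongr
      rw [Real.inv_rpow hd0.le, ← Real.rpow_neg hd0.le] at h4
      rw [sub_eq_add_neg, Real.rpow_add hd0]
      gcongr
    nlinarith

/-- Main comparison: the supersolution dominates a multiple of the barrier. -/
lemma compare_barrier (N : ℕ) (hN : 2 ≤ N) (γ α : ℝ) (hα0 : 0 < α) (hαγ : α < γ) (h1 : γ < 1)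
    (h2 : γ < 2 * α) (u : EuclideanSpace ℝ (Fin N) → ℝ) (hu_cont : Continuous u)
    (p : EuclideanSpace ℝ (Fin N)) (hnn : ∀ x, 0 ≤ u x) (hpos : ∀ x, ‖x - p‖ < 1 → 0 < u x)
    (hu_super : ∀ x : EuclideanSpace ℝ (Fin N), ‖x - p‖ < 1 →
      Integrable (fun y => nlD u x y * ‖y‖ ^ (-((N : ℝ) + 2 * α))) ∧
      ∫ y, nlD u x y * ‖y‖ ^ (-((N : ℝ) + 2 * α)) ≤ 0) :
    ∃ m : ℝ, 0 < m ∧ ∀ x, m * (max (1 - ‖x - p‖ ^ 2) 0) ^ γ ≤ u x := by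
  have h0 : 0 < γ := hα0.trans hαγ
  obtain ⟨ρ, hρ0, hρ1, hρ⟩ := barrier_sub N hN γ α hα0 hαγ h1 h2 p
  obtain ⟨xm, hxm, hmin⟩ := (isCompact_closedBall p ρ).exists_isMinOn
    (Metric.nonempty_closedBall.2 hρ0.le) hu_cont.continuousOn
  have hxm' : ‖xm - p‖ ≤ ρ := by simpa [dist_eq_norm] using hxm
  set m := u xm with hm
  have hm0 : 0 < m := hpos xm (by linarith)
  refine ⟨m, hm0, ?_⟩
  set ψ : EuclideanSpace ℝ (Fin N) → ℝ := fun w => (max (1 - ‖w - p‖ ^ 2) 0) ^ γ with hψ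
  have hψc : Continuous ψ :=
    (by fun_prop : Continuous fun w : EuclideanSpace ℝ (Fin N) =>
      max (1 - ‖w - p‖ ^ 2) 0).rpow_const fun _ => Or.inr h0.le
  have hψ1 : ∀ w, ψ w ≤ 1 := fun w =>
    Real.rpow_le_one (le_max_right _ _)
      (max_le (by nlinarith [sq_nonneg ‖w - p‖]) (by norm_num)) h0.le
  by_contra hcon
  push Not at hcon
  obtain ⟨x1, hx1⟩ := hcon
  have hout : ∀ x, 1 ≤ ‖x - p‖ → 0 ≤ u x - m * ψ x := by
    intro x hx
    have : ψ x = 0 := by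
      simp only [hψ]
      rw [max_eq_right (by nlinarith), Real.zero_rpow h0.ne']
    rw [this]; linarith [hnn x]
  have hin : ∀ x, ‖x - p‖ ≤ ρ → 0 ≤ u x - m * ψ x := by
    intro x hx
    have a1 : m ≤ u x := hmin (by simpa [dist_eq_norm] using hx)
    nlinarith [hψ1 x]
  have hwc : Continuous fun x => u x - m * ψ x := by fun_prop
  obtain ⟨x0, hx0, hmin0⟩ := (isCompact_closedBall p 1).exists_isMinOn
    (Metric.nonempty_closedBall.2 zero_le_one) hwc.continuousOn
  have hx1' : u x1 - m * ψ x1 < 0 := by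
    have : u x1 < m * ψ x1 := hx1
    linarith
  have hx1b : ‖x1 - p‖ < 1 := by
    by_contra h
    linarith [hout x1 (not_lt.1 h)]
  have hneg : u x0 - m * ψ x0 < 0 := by
    have : u x0 - m * ψ x0 ≤ u x1 - m * ψ x1 :=
      hmin0 (by simpa [dist_eq_norm] using hx1b.le)
    linarith
  have hglob : ∀ x, u x0 - m * ψ x0 ≤ u x - m * ψ x := by
    intro x
    rcases le_total ‖x - p‖ 1 with h | h
    · exact hmin0 (by simpa [dist_eq_norm] using h)
    · linarith [hout x h]
  have hb1 : ‖x0 - p‖ < 1 := by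
    by_contra h
    linarith [hout x0 (not_lt.1 h)]
  have hb2 : ρ < ‖x0 - p‖ := by
    by_contra h
    linarith [hin x0 (not_lt.1 h)]
  obtain ⟨L, hL1, hL2, hL3⟩ := hρ x0 hb1 hb2
  obtain ⟨su1, su2⟩ := hu_super x0 hb1
  have hle : ∫ y, m * (L y * ‖y‖ ^ (-((N : ℝ) + 2 * α))) ≤
      ∫ y, nlD u x0 y * ‖y‖ ^ (-((N : ℝ) + 2 * α)) := by
    refine integral_mono (hL2.const_mul m) su1 fun y => ?_
    simp only
    rw [← mul_assoc]
    refine mul_le_mul_of_nonneg_right ?_ (by positivity)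
    have c1 : m * L y ≤ m * nlD ψ x0 y := mul_le_mul_of_nonneg_left (hL1 y) hm0.le
    refine c1.trans ?_
    unfold nlD
    linarith [hglob (x0 + y), hglob (x0 - y)]
  rw [integral_const_mul] at hle
  have := mul_pos hm0 hL3
  linarith

/-- Hopf-type lemma at the vertex, half-space instance (Theorem 1.4 for the
fractional Laplacian, where `β⁻ = -α`). -/
theorem hopf_at_vertex_halfspace
    (N : ℕ) (hN : 2 ≤ N) (α : ℝ) (hα : α ∈ Set.Ioo (0 : ℝ) 1)
    (u : EuclideanSpace ℝ (Fin N) → ℝ)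
    (hu_cont : Continuous u)
    (hu_bdd : ∃ M : ℝ, ∀ x, |u x| ≤ M)
    (hu_pos : ∀ x : EuclideanSpace ℝ (Fin N), 0 < x ⟨N - 1, by omega⟩ → 0 < u x)
    (hu_zero : ∀ x : EuclideanSpace ℝ (Fin N), ¬ (0 < x ⟨N - 1, by omega⟩) → u x = 0)
    (hu_super : ∀ x : EuclideanSpace ℝ (Fin N), 0 < x ⟨N - 1, by omega⟩ →
      Integrable (fun y => nlD u x y * ‖y‖ ^ (-((N : ℝ) + 2 * α))) ∧
      ∫ y, nlD u x y * ‖y‖ ^ (-((N : ℝ) + 2 * α)) ≤ 0) :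
    ∀ ω₀ : Set (EuclideanSpace ℝ (Fin N)), IsCompact ω₀ →
      ω₀ ⊆ {e | ‖e‖ = 1 ∧ 0 < e ⟨N - 1, by omega⟩} →
      ∀ β ∈ Set.Ioo (-(2 * α)) (-α),
        ∃ C : ℝ, 0 < C ∧ ∃ t₀ : ℝ, 0 < t₀ ∧
          ∀ e ∈ ω₀, ∀ t : ℝ, 0 < t → t < t₀ →
            C * t ^ (-β) ≤ u (t • e) := by
  intro ω₀ hω hωs β hβ
  obtain ⟨hα0, hα1⟩ := hα
  obtain ⟨hβ1, hβ2⟩ := hβ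
  set i : Fin N := ⟨N - 1, by omega⟩ with hi
  obtain ⟨γ, hαγ, hγ⟩ : ∃ γ, α < γ ∧ γ < min (-β) 1 :=
    exists_between (lt_min (by linarith) hα1)
  have hγβ : γ < -β := lt_of_lt_of_le hγ (min_le_left _ _)
  have hγ1 : γ < 1 := lt_of_lt_of_le hγ (min_le_right _ _)
  have hγ0 : 0 < γ := hα0.trans hαγ
  let p : EuclideanSpace ℝ (Fin N) := EuclideanSpace.single i 1
  have hp : ‖p‖ = 1 := by simp [p]
  have hH : ∀ x : EuclideanSpace ℝ (Fin N), ‖x - p‖ < 1 → 0 < x i := by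
    intro x hx
    have h3 := PiLp.norm_apply_le (x - p) i
    have h4 : (x - p) i = x i - 1 := by simp [p]
    rw [h4, Real.norm_eq_abs] at h3
    have := abs_lt.1 (h3.trans_lt hx)
    linarith [this.1]
  have hnn : ∀ x, 0 ≤ u x := by
    intro x
    by_cases h : 0 < x i
    · exact (hu_pos x h).le
    · exact (hu_zero x h).ge
  obtain ⟨m, hm0, hm⟩ := compare_barrier N hN γ α hα0 hαγ hγ1 (by linarith) u hu_cont p hnn
    (fun x hx => hu_pos x (hH x hx)) (fun x hx => hu_super x (hH x hx))
  obtain ⟨s, hs0, hs⟩ : ∃ s : ℝ, 0 < s ∧ ∀ e ∈ ω₀, s ≤ e i := by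
    rcases ω₀.eq_empty_or_nonempty with h | h
    · exact ⟨1, one_pos, by simp [h]⟩
    · obtain ⟨e, he, hemin⟩ := hω.exists_isMinOn h
        (by fun_prop : Continuous fun e : EuclideanSpace ℝ (Fin N) => e i).continuousOn
      exact ⟨e i, (hωs he).2, fun e' he' => hemin he'⟩
  refine ⟨m * s ^ γ, by positivity, min s 1, lt_min hs0 one_pos, ?_⟩
  intro e he t ht0 ht
  have hts : t < s := lt_of_lt_of_le ht (min_le_left _ _)
  have ht1 : t < 1 := lt_of_lt_of_le ht (min_le_right _ _)
  have hen : ‖e‖ = 1 := (hωs he).1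
  have hei : s ≤ e i := hs e he
  have hinner : inner ℝ e p = e i := by
    simp [p, EuclideanSpace.inner_single_right]
  have hcalc : s * t ≤ 1 - ‖t • e - p‖ ^ 2 := by
    rw [norm_sub_sq_real, norm_smul, real_inner_smul_left, hinner, hen, hp,
      Real.norm_of_nonneg ht0.le]
    nlinarith
  calc m * s ^ γ * t ^ (-β) ≤ m * s ^ γ * t ^ γ := by
        gcongr m * s ^ γ * ?_
        exact Real.rpow_le_rpow_of_exponent_ge ht0 ht1.le hγβ.le
    _ = m * (s * t) ^ γ := by rw [Real.mul_rpow hs0.le ht0.le]; ring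
    _ ≤ m * (max (1 - ‖t • e - p‖ ^ 2) 0) ^ γ := by
        gcongr
        exact hcalc.trans (le_max_left _ _)
    _ ≤ u (t • e) := hm _
end

section
/- Lower bound at infinity for positive supersolutions, half-space instance (Lemma 4.2 for the fractional Laplacian, where β⁺ = N − α). Let N ≥ 2, α ∈ (0,1), H = {x ∈ ℝ^N : x_N > 0}, and fix β ∈ (N−α, N). Let u : ℝ^N → ℝ be continuous with u ≥ 0 on ℝ^N, u(x) > 0 for all x ∈ H, and such that for every x ∈ H the function y ↦ δ(u,x,y) |y|^{−(N+2α)} is Lebesgue integrable on ℝ^N with ∫_{ℝ^N} δ(u,x,y) |y|^{−(N+2α)} dy ≤ 0. Then for every compact set ω₀ contained in the open upper hemisphere {e ∈ S^{N−1} : e_N > 0} there exist constants C > 0 and R₁ > 0 such that u(x) ≥ C |x|^{−β} for every x with x/|x| ∈ ω₀ and |x| ≥ R₁. -/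
open MeasureTheory

section Helpers

open Set EuclideanGeometry
open scoped Pointwise

lemma oneD_A_int {α η : ℝ} (h0 : 0 < α) (h1 : α < 1) (hη : 0 < η) :
    IntegrableOn (fun r : ℝ => ((1 + r) ^ α - 1) * r ^ (-1 - 2 * α)) (Ioi η) := by
  have hI : IntegrableOn (fun r : ℝ => r ^ (-1 - α)) (Ioi η) :=
    integrableOn_Ioi_rpow_of_lt (by linarith) hη
  refine Integrable.mono' hI ?_ ?_
  · apply ContinuousOn.aestronglyMeasurable _ measurableSet_Ioi
    intro r hr
    have hr' : 0 < r := hη.trans hr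
    apply ContinuousAt.continuousWithinAt
    apply ContinuousAt.mul
    · apply ContinuousAt.sub _ continuousAt_const
      exact ContinuousAt.rpow (by fun_prop) continuousAt_const (Or.inl (by positivity))
    · exact ContinuousAt.rpow continuousAt_id continuousAt_const (Or.inl hr'.ne')
  · refine (ae_restrict_mem measurableSet_Ioi).mono fun r hr => ?_
    have hr' : 0 < r := hη.trans hr
    have e1 : (1 + r) ^ α ≤ 1 + r ^ α := by
      have := Real.rpow_add_le_add_rpow (zero_le_one) hr'.le h0.le h1.le
      simpa using this
    have e2 : 1 ≤ (1 + r) ^ α := Real.one_le_rpow (by linarith) h0.le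
    have e3 : r ^ α * r ^ (-1 - 2 * α) = r ^ (-1 - α) := by
      rw [← Real.rpow_add hr']; ring_nf
    have e4 : 0 < r ^ (-1 - 2 * α) := by positivity
    rw [Real.norm_eq_abs, abs_of_nonneg (mul_nonneg (by linarith) e4.le), ← e3]
    gcongr
    linarith

lemma oneD_B_int {α η : ℝ} (h0 : 0 < α) (h1 : α < 1) (hη : 0 < η) :
    IntegrableOn (fun r : ℝ => ((max (1 - r) 0) ^ α - 1) * r ^ (-1 - 2 * α)) (Ioi η) := by
  have hI : IntegrableOn (fun r : ℝ => r ^ (-1 - 2 * α)) (Ioi η) :=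
    integrableOn_Ioi_rpow_of_lt (by linarith) hη
  refine Integrable.mono' hI ?_ ?_
  · apply ContinuousOn.aestronglyMeasurable _ measurableSet_Ioi
    intro r hr
    have hr' : 0 < r := hη.trans hr
    apply ContinuousAt.continuousWithinAt
    apply ContinuousAt.mul
    · apply ContinuousAt.sub _ continuousAt_const
      exact ContinuousAt.rpow (by fun_prop) continuousAt_const (Or.inr h0)
    · exact ContinuousAt.rpow continuousAt_id continuousAt_const (Or.inl hr'.ne')
  · refine (ae_restrict_mem measurableSet_Ioi).mono fun r hr => ?_
    have hr' : 0 < r := hη.trans hr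
    have e2 : (max (1 - r) 0) ^ α ≤ 1 :=
      Real.rpow_le_one (by positivity) (max_le (by linarith) zero_le_one) h0.le
    have e3 : 0 ≤ (max (1 - r) 0) ^ α := by positivity
    have e4 : 0 < r ^ (-1 - 2 * α) := by positivity
    rw [norm_mul, Real.norm_eq_abs, Real.norm_eq_abs, abs_of_pos e4]
    have : |(max (1 - r) 0) ^ α - 1| ≤ 1 := abs_le.2 ⟨by linarith, by linarith⟩
    nlinarith

lemma oneD_subst {α η : ℝ} (h0 : 0 < α) (h1 : α < 1) (hη : 0 < η) :
    IntegrableOn (fun x : ℝ => ((1 - x) ^ (α - 1) - (1 - x) ^ (2 * α - 1)) * x ^ (-1 - 2 * α))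
      (Ioo η 1) ∧
    ∫ x in Ioo η 1, ((1 - x) ^ (α - 1) - (1 - x) ^ (2 * α - 1)) * x ^ (-1 - 2 * α) ≤
      ∫ r in Ioi η, ((1 + r) ^ α - 1) * r ^ (-1 - 2 * α) := by
  set s : Set ℝ := Ioo (η / (1 + η)) 1 with hs
  have hpos : 0 < η / (1 + η) := by positivity
  have him : (fun x : ℝ => x / (1 - x)) '' s = Ioi η := by
    ext r
    constructor
    · rintro ⟨x, ⟨hx1, hx2⟩, rfl⟩
      have : 0 < 1 - x := by linarith
      simp only [mem_Ioi]
      rw [lt_div_iff₀ this]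
      rw [div_lt_iff₀ (by positivity)] at hx1
      linarith
    · intro hr
      have hr' : η < r := hr
      have : 0 < 1 + r := by linarith
      refine ⟨r / (1 + r), ⟨?_, ?_⟩, ?_⟩
      · rw [div_lt_div_iff₀ (by positivity) this]; linarith
      · rw [div_lt_one this]; linarith
      · field_simp; ring
  have hd : ∀ x ∈ s, HasDerivWithinAt (fun x : ℝ => x / (1 - x)) (1 / (1 - x) ^ 2) s x := by
    intro x hx
    have : 1 - x ≠ 0 := by have := hx.2; linarith
    apply HasDerivAt.hasDerivWithinAt
    have := (hasDerivAt_id x).div ((hasDerivAt_id x).const_sub 1) this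
    refine this.congr_deriv ?_
    simp
  have hinj : InjOn (fun x : ℝ => x / (1 - x)) s := by
    intro x hx y hy hxy
    have h1 : 1 - x ≠ 0 := by have := hx.2; linarith
    have h2 : 1 - y ≠ 0 := by have := hy.2; linarith
    simp only at hxy
    rw [div_eq_div_iff h1 h2] at hxy
    linarith
  have hf : ∀ x ∈ s, |1 / (1 - x) ^ 2| • (((1 + x / (1 - x)) ^ α - 1) * (x / (1 - x)) ^ (-1 - 2 * α))
      = ((1 - x) ^ (α - 1) - (1 - x) ^ (2 * α - 1)) * x ^ (-1 - 2 * α) := by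
    intro x hx
    have hy : 0 < 1 - x := by have := hx.2; linarith
    have hx0 : 0 < x := hpos.trans hx.1
    have e1 : 1 + x / (1 - x) = (1 - x)⁻¹ := by field_simp; ring
    rw [e1, abs_of_pos (by positivity), smul_eq_mul, Real.inv_rpow hy.le, ← Real.rpow_neg hy.le,
      Real.div_rpow hx0.le hy.le, div_eq_mul_inv, div_eq_mul_inv, ← Real.rpow_neg hy.le]
    have e2 : 1 * ((1 - x) ^ 2)⁻¹ = (1 - x) ^ (-2 : ℝ) := by
      rw [Real.rpow_neg hy.le]; simp
    rw [e2]
    have e3 : (1 - x) ^ (α - 1) = (1 - x) ^ (-2 : ℝ) * (1 - x) ^ (-α) * (1 - x) ^ (-(-1 - 2 * α)) := by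
      rw [← Real.rpow_add hy, ← Real.rpow_add hy]; ring_nf
    have e4 : (1 - x) ^ (2 * α - 1) = (1 - x) ^ (-2 : ℝ) * (1 - x) ^ (-(-1 - 2 * α)) := by
      rw [← Real.rpow_add hy]; ring_nf
    rw [e3, e4]; ring
  have hA := oneD_A_int h0 h1 hη
  rw [← him] at hA
  rw [integrableOn_image_iff_integrableOn_abs_deriv_smul measurableSet_Ioo hd hinj] at hA
  have hA' := hA.congr_fun hf measurableSet_Ioo
  have hsub : Ioo η 1 ⊆ s := by
    apply Ioo_subset_Ioo_left
    apply div_le_self hη.le; linarith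
  refine ⟨hA'.mono_set hsub, ?_⟩
  rw [← him, integral_image_eq_integral_abs_deriv_smul measurableSet_Ioo hd hinj,
    setIntegral_congr_fun measurableSet_Ioo hf]
  apply setIntegral_mono_set hA' _ hsub.eventuallyLE
  refine (ae_restrict_mem measurableSet_Ioo).mono fun x hx => ?_
  have hy : 0 < 1 - x := by have := hx.2; linarith
  have hx0 : 0 < x := hpos.trans hx.1
  apply mul_nonneg _ (by positivity)
  rw [sub_nonneg]
  exact Real.rpow_le_rpow_of_exponent_ge hy (by linarith) (by linarith)

lemma oneD {α η : ℝ} (h0 : 0 < α) (h1 : α < 1) (hη : 0 < η) (hη1 : η < 1) :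
    -(η ^ (2 - 2 * α) / (2 * α)) ≤
    ∫ r in Ioi η, ((max (1 + r) 0) ^ α + (max (1 - r) 0) ^ α - 2) * r ^ (-1 - 2 * α) := by
  have hA := oneD_A_int h0 h1 hη
  have hB := oneD_B_int h0 h1 hη
  obtain ⟨hS, hS'⟩ := oneD_subst h0 h1 hη
  have e1 : ∫ r in Ioi η, ((max (1 + r) 0) ^ α + (max (1 - r) 0) ^ α - 2) * r ^ (-1 - 2 * α)
      = (∫ r in Ioi η, ((1 + r) ^ α - 1) * r ^ (-1 - 2 * α)) +
        ∫ r in Ioi η, ((max (1 - r) 0) ^ α - 1) * r ^ (-1 - 2 * α) := by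
    rw [← integral_add hA hB]
    apply setIntegral_congr_fun measurableSet_Ioi
    intro r hr
    have hr' : 0 < r := hη.trans hr
    simp only
    rw [max_eq_left (by linarith : 0 ≤ 1 + r)]
    ring
  have hun : Ioi η = Ioc η 1 ∪ Ioi 1 := (Ioc_union_Ioi_eq_Ioi hη1.le).symm
  have hB1 : IntegrableOn (fun r : ℝ => ((max (1 - r) 0) ^ α - 1) * r ^ (-1 - 2 * α)) (Ioc η 1) :=
    hB.mono_set Ioc_subset_Ioi_self
  have hB2 : IntegrableOn (fun r : ℝ => ((max (1 - r) 0) ^ α - 1) * r ^ (-1 - 2 * α)) (Ioi 1) :=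
    hB.mono_set (Ioi_subset_Ioi hη1.le)
  have e2 : ∫ r in Ioi η, ((max (1 - r) 0) ^ α - 1) * r ^ (-1 - 2 * α) =
      (∫ r in Ioo η 1, ((1 - r) ^ α - 1) * r ^ (-1 - 2 * α)) - 1 / (2 * α) := by
    rw [hun, setIntegral_union (by simp) measurableSet_Ioi hB1 hB2,
      integral_Ioc_eq_integral_Ioo, sub_eq_add_neg (∫ r in Ioo η 1, _)]
    congr 1
    · apply setIntegral_congr_fun measurableSet_Ioo
      intro r hr
      simp only
      rw [max_eq_left (by linarith [hr.2])]
    · have : ∫ r in Ioi (1:ℝ), ((max (1 - r) 0) ^ α - 1) * r ^ (-1 - 2 * α) =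
          ∫ r in Ioi (1:ℝ), -(r ^ (-1 - 2 * α)) := by
        apply setIntegral_congr_fun measurableSet_Ioi
        intro r hr
        simp only
        rw [max_eq_right (by linarith [mem_Ioi.1 hr]), Real.zero_rpow h0.ne']
        ring
      rw [this, integral_neg, integral_Ioi_rpow_of_lt (by linarith) one_pos, Real.one_rpow,
        (by ring : -1 - 2 * α + 1 = -(2 * α)), neg_div_neg_eq]
  have hB1' : IntegrableOn (fun r : ℝ => ((1 - r) ^ α - 1) * r ^ (-1 - 2 * α)) (Ioo η 1) := by
    refine (hB1.mono_set Ioo_subset_Ioc_self).congr_fun ?_ measurableSet_Ioo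
    intro r hr
    simp only
    rw [max_eq_left (by linarith [hr.2])]
  set P : ℝ → ℝ := fun x => x ^ (-(2 * α)) * (1 - (1 - x) ^ α) ^ 2 / (2 * α) with hP
  have hsum : IntegrableOn (fun x : ℝ => ((1 - x) ^ α - 1) * x ^ (-1 - 2 * α) +
      ((1 - x) ^ (α - 1) - (1 - x) ^ (2 * α - 1)) * x ^ (-1 - 2 * α)) (Ioo η 1) := hB1'.add hS
  have hFTC : ∫ x in Ioo η 1, (((1 - x) ^ α - 1) * x ^ (-1 - 2 * α) +
      ((1 - x) ^ (α - 1) - (1 - x) ^ (2 * α - 1)) * x ^ (-1 - 2 * α)) = P 1 - P η := by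
    rw [← integral_Ioc_eq_integral_Ioo, ← intervalIntegral.integral_of_le hη1.le]
    apply intervalIntegral.integral_eq_sub_of_hasDerivAt_of_le hη1.le
    · intro x hx
      have hx0 : 0 < x := hη.trans_le hx.1
      apply ContinuousAt.continuousWithinAt
      apply ContinuousAt.div_const
      apply ContinuousAt.mul
      · exact ContinuousAt.rpow continuousAt_id continuousAt_const (Or.inl hx0.ne')
      · apply ContinuousAt.pow
        apply ContinuousAt.sub continuousAt_const
        exact ContinuousAt.rpow (by fun_prop) continuousAt_const (Or.inr h0)
    · intro x hx
      have hx0 : 0 < x := hη.trans hx.1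
      have hy : 0 < 1 - x := by linarith [hx.2]
      have d1 : HasDerivAt (fun x : ℝ => x ^ (-(2 * α))) (-(2 * α) * x ^ (-(2 * α) - 1)) x :=
        Real.hasDerivAt_rpow_const (Or.inl hx0.ne')
      have d2 : HasDerivAt (fun x : ℝ => (1 - x) ^ α) (-1 * α * (1 - x) ^ (α - 1)) x :=
        ((hasDerivAt_id x).const_sub 1).rpow_const (Or.inl hy.ne')
      have d3 := ((d1.mul ((d2.const_sub 1).pow 2)).div_const (2 * α))
      refine d3.congr_deriv ?_
      simp only [Pi.pow_apply]
      have f1 : x ^ (-(2 * α)) = x * x ^ (-1 - 2 * α) := by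
        nth_rewrite 2 [← Real.rpow_one x]
        rw [← Real.rpow_add hx0]; ring_nf
      have f2 : x ^ (-(2 * α) - 1) = x ^ (-1 - 2 * α) := by ring_nf
      have f3 : (1 - x) ^ α = (1 - x) * (1 - x) ^ (α - 1) := by
        nth_rewrite 2 [← Real.rpow_one (1 - x)]
        rw [← Real.rpow_add hy]; ring_nf
      have f4 : (1 - x) ^ (2 * α - 1) = (1 - x) * ((1 - x) ^ (α - 1) * (1 - x) ^ (α - 1)) := by
        nth_rewrite 2 [← Real.rpow_one (1 - x)]
        rw [← Real.rpow_add hy, ← Real.rpow_add hy]; ring_nf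
      rw [f1, f2, f3, f4]
      field_simp
      ring
    · rw [intervalIntegrable_iff_integrableOn_Ioo_of_le hη1.le]
      exact hsum
  rw [integral_add hB1' hS] at hFTC
  have hP1 : P 1 = 1 / (2 * α) := by simp [hP, Real.zero_rpow h0.ne']
  have hPη : P η ≤ η ^ (2 - 2 * α) / (2 * α) := by
    simp only [hP]
    have g1 : 1 - η ≤ (1 - η) ^ α := by
      have := Real.rpow_le_rpow_of_exponent_ge (by linarith : 0 < 1 - η) (by linarith) h1.le
      simpa using this
    have g2 : (1 - η) ^ α ≤ 1 := Real.rpow_le_one (by linarith) (by linarith) h0.le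
    have g3 : η ^ (2 - 2 * α) = η ^ (-(2 * α)) * η ^ 2 := by
      rw [← Real.rpow_natCast η 2, ← Real.rpow_add hη]; push_cast; ring_nf
    rw [g3]
    gcongr
    · linarith
  linarith

lemma kernel_int {N : ℕ} {r ε : ℝ} (hr : (N : ℝ) < r) (hε : 0 < ε) :
    IntegrableOn (fun y : EuclideanSpace ℝ (Fin N) => ‖y‖ ^ (-r)) {y | ε < ‖y‖} := by
  have hJ : Integrable (fun y : EuclideanSpace ℝ (Fin N) => (1 + ‖y‖) ^ (-r)) :=
    integrable_one_add_norm (by simpa using hr)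
  have hr0 : 0 < r := lt_of_le_of_lt (Nat.cast_nonneg N) hr
  have hm : MeasurableSet {y : EuclideanSpace ℝ (Fin N) | ε < ‖y‖} :=
    measurableSet_lt measurable_const measurable_norm
  refine Integrable.mono' ((hJ.const_mul ((ε / (1 + ε)) ^ (-r))).integrableOn) ?_ ?_
  · exact (measurable_norm.pow_const _).aestronglyMeasurable
  · refine (ae_restrict_mem hm).mono fun y hy => ?_
    have hy' : ε < ‖y‖ := hy
    have hy0 : 0 < ‖y‖ := hε.trans hy'
    rw [Real.norm_eq_abs, abs_of_nonneg (by positivity), ← Real.mul_rpow (by positivity) (by positivity)]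
    apply Real.rpow_le_rpow_of_nonpos (by positivity) _ (by linarith)
    rw [div_mul_eq_mul_div, div_le_iff₀ (by positivity)]
    nlinarith

lemma origin_int {N : ℕ} (hN : 2 ≤ N) {γ : ℝ} (hr : γ < N) :
    IntegrableOn (fun y : EuclideanSpace ℝ (Fin N) => ‖y‖ ^ (-γ)) (Metric.ball 0 2) := by
  have : Nonempty (Fin N) := ⟨⟨0, by omega⟩⟩
  have : Nontrivial (EuclideanSpace ℝ (Fin N)) := inferInstance
  rw [integrableOn_fun_norm_addHaar volume (f := fun y => y ^ (-γ))]
  have : IntegrableOn (fun y : ℝ => y ^ ((N : ℝ) - 1 - γ)) (Ioo 0 2) := by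
    rw [intervalIntegral.integrableOn_Ioo_rpow_iff two_pos]; linarith
  refine this.congr_fun ?_ measurableSet_Ioo
  intro y hy
  simp only [finrank_euclideanSpace, Fintype.card_fin, smul_eq_mul]
  rw [← Real.rpow_natCast, ← Real.rpow_add hy.1, Nat.cast_sub (by omega)]
  push_cast; ring_nf

/-- Polar coordinates lower bound. -/
lemma polar_lower {N : ℕ} (hN : 2 ≤ N) : ∃ M : ℝ, 0 ≤ M ∧
    ∀ (G : EuclideanSpace ℝ (Fin N) → ℝ) (c : ℝ), Integrable G →
    (∀ θ : EuclideanSpace ℝ (Fin N), ‖θ‖ = 1 → c ≤ ∫ r in Ioi (0 : ℝ), r ^ (N - 1) * G (r • θ)) →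
    M * c ≤ ∫ y, G y := by
  have : Nonempty (Fin N) := ⟨⟨0, by omega⟩⟩
  have : Nontrivial (EuclideanSpace ℝ (Fin N)) := inferInstance
  set E := EuclideanSpace ℝ (Fin N)
  let μ : Measure E := volume
  refine ⟨μ.toSphere.real univ, by positivity, fun G c hG h => ?_⟩
  have hdim : Module.finrank ℝ E = N := by simp [E]
  have hmp := μ.measurePreserving_homeomorphUnitSphereProd
  rw [hdim] at hmp
  let F : Metric.sphere (0 : E) 1 × Ioi (0 : ℝ) → ℝ := fun p => G (p.2.1 • p.1.1)
  have hFc : ∀ x : ({(0 : E)}ᶜ : Set E), F (homeomorphUnitSphereProd E x) = G x := by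
    intro x
    simp only [F]
    congr 1
    have hx : ‖(x : E)‖ ≠ 0 := norm_ne_zero_iff.2 x.2
    simp [smul_smul, hx]
  have e1 : ∫ y, G y = ∫ p, F p ∂(μ.toSphere.prod (.volumeIoiPow (N - 1))) := by
    rw [← hmp.integral_comp (Homeomorph.measurableEmbedding _)]
    simp_rw [hFc]
    rw [integral_subtype_comap (measurableSet_singleton _).compl fun x ↦ G x,
        restrict_compl_singleton]
  have hFi : Integrable F (μ.toSphere.prod (.volumeIoiPow (N - 1))) := by
    rw [← hmp.integrable_comp_emb (Homeomorph.measurableEmbedding _)]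
    have : F ∘ (homeomorphUnitSphereProd E) = fun x => G x.1 := funext hFc
    rw [this]
    have h2 : IntegrableOn G ({(0 : E)}ᶜ) μ := hG.integrableOn
    rw [integrableOn_iff_comap_subtypeVal (measurableSet_singleton _).compl] at h2
    exact h2
  rw [e1, integral_prod _ hFi]
  have e2 : ∀ θ : Metric.sphere (0 : E) 1, ∫ r, F (θ, r) ∂(Measure.volumeIoiPow (N - 1)) =
      ∫ r in Ioi (0 : ℝ), r ^ (N - 1) * G (r • θ.1) := by
    intro θ
    simp only [Measure.volumeIoiPow, ENNReal.ofReal]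
    rw [integral_withDensity_eq_integral_smul, 
      ← integral_subtype_comap measurableSet_Ioi (fun r : ℝ => r ^ (N - 1) * G (r • θ.1))]
    · apply integral_congr_ae
      refine .of_forall ?_
      rintro ⟨r, hr⟩
      have : 0 < r := hr
      simp [F, NNReal.smul_def, Real.coe_toNNReal _ (pow_nonneg this.le _)]
    · fun_prop
  calc μ.toSphere.real univ * c = ∫ θ, c ∂μ.toSphere := by simp
    _ ≤ _ := by
      apply integral_mono (integrable_const _) hFi.integral_prod_left
      intro θ
      simp only
      rw [e2]
      exact h θ (by simp)

/-- The function `(z_i)_+ ^ α`. -/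
noncomputable def wf {N : ℕ} (α : ℝ) (i : Fin N) (z : EuclideanSpace ℝ (Fin N)) : ℝ :=
  (max (z i) 0) ^ α

lemma wf_nonneg {N : ℕ} (α : ℝ) (i : Fin N) (z : EuclideanSpace ℝ (Fin N)) : 0 ≤ wf α i z := by
  unfold wf; positivity

lemma coord_le {N : ℕ} (i : Fin N) (z : EuclideanSpace ℝ (Fin N)) : |z i| ≤ ‖z‖ := by
  simpa using PiLp.norm_apply_le z i

lemma wf_le {N : ℕ} {α : ℝ} (h0 : 0 < α) (i : Fin N) (z : EuclideanSpace ℝ (Fin N)) :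
    wf α i z ≤ ‖z‖ ^ α := by
  unfold wf
  have := coord_le i z
  have h2 := le_abs_self (z i)
  exact Real.rpow_le_rpow (by positivity) (max_le (by linarith) (norm_nonneg _)) h0.le

lemma wf_cont {N : ℕ} {α : ℝ} (h0 : 0 < α) (i : Fin N) : Continuous (wf (N := N) α i) := by
  unfold wf
  apply Continuous.rpow_const (by fun_prop)
  intro x; right; exact h0.le

lemma wf_int {N : ℕ} {α ε : ℝ} (h0 : 0 < α) (i : Fin N) (hε : 0 < ε)
    (e : EuclideanSpace ℝ (Fin N)) :
    IntegrableOn (fun y : EuclideanSpace ℝ (Fin N) => wf α i (e + y) * ‖y‖ ^ (-((N : ℝ) + 2 * α)))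
      {y | ε < ‖y‖} := by
  have hm : MeasurableSet {y : EuclideanSpace ℝ (Fin N) | ε < ‖y‖} :=
    measurableSet_lt measurable_const measurable_norm
  have hk := kernel_int (N := N) (r := N + α) (by linarith) hε
  refine Integrable.mono' (hk.const_mul ((‖e‖ / ε + 1) ^ α)) ?_ ?_
  · apply Measurable.aestronglyMeasurable
    have := (wf_cont h0 i).measurable
    fun_prop
  · refine (ae_restrict_mem hm).mono fun y hy => ?_
    have hy' : ε < ‖y‖ := hy
    have hy0 : 0 < ‖y‖ := hε.trans hy'
    rw [Real.norm_eq_abs, abs_of_nonneg (mul_nonneg (wf_nonneg _ _ _) (by positivity))]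
    have h1 : ‖e + y‖ ≤ (‖e‖ / ε + 1) * ‖y‖ := by
      refine (norm_add_le _ _).trans ?_
      have : ‖e‖ = ‖e‖ / ε * ε := by field_simp
      have h3 : 0 ≤ ‖e‖ / ε := by positivity
      nlinarith
    have h2 : wf α i (e + y) ≤ (‖e‖ / ε + 1) ^ α * ‖y‖ ^ α := by
      refine (wf_le h0 i _).trans ?_
      rw [← Real.mul_rpow (by positivity) (by positivity)]
      exact Real.rpow_le_rpow (by positivity) h1 h0.le
    have h3 : ‖y‖ ^ (-((N : ℝ) + α)) = ‖y‖ ^ α * ‖y‖ ^ (-((N : ℝ) + 2 * α)) := by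
      rw [← Real.rpow_add hy0]; ring_nf
    rw [h3, ← mul_assoc]
    gcongr

lemma ray_bound {α t s ε : ℝ} (h0 : 0 < α) (h1 : α < 1) (ht : 0 < t) (hs : |s| ≤ 1) (hε : 0 < ε)
    (hεt : ε < t) :
    -(t ^ α * t⁻¹ ^ 2 * ε ^ (2 - 2 * α) / (2 * α)) ≤
    ∫ r in Ioi ε, ((max (t + r * s) 0) ^ α + (max (t - r * s) 0) ^ α - 2 * t ^ α)
      * r ^ (-1 - 2 * α) := by
  rcases eq_or_ne s 0 with rfl | hs0
  · have : ∀ r : ℝ, ((max (t + r * 0) 0) ^ α + (max (t - r * 0) 0) ^ α - 2 * t ^ α)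
      * r ^ (-1 - 2 * α) = 0 := by
      intro r
      simp only [mul_zero, add_zero, sub_zero, max_eq_left ht.le]; ring
    simp only [this, integral_zero]
    rw [neg_nonpos]; positivity
  · set k := |s| / t with hk
    have hk0 : 0 < k := by have := abs_pos.2 hs0; positivity
    have hkε : k * ε < 1 := by
      rw [hk, div_mul_eq_mul_div, div_lt_one ht]; nlinarith [abs_nonneg s]
    have key := oneD h0 h1 (mul_pos hk0 hε) hkε
    have e1 : ∫ r in Ioi ε, ((max (t + r * s) 0) ^ α + (max (t - r * s) 0) ^ α - 2 * t ^ α)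
        * r ^ (-1 - 2 * α) = ∫ r in Ioi ε, (t ^ α * k ^ (1 + 2 * α)) *
        (fun x : ℝ => ((max (1 + x) 0) ^ α + (max (1 - x) 0) ^ α - 2) * x ^ (-1 - 2 * α)) (k * r) := by
      apply setIntegral_congr_fun measurableSet_Ioi
      intro r hr
      have hr0 : 0 < r := hε.trans hr
      simp only
      have a1 : (max (t + r * s) 0) ^ α + (max (t - r * s) 0) ^ α =
          t ^ α * ((max (1 + k * r) 0) ^ α + (max (1 - k * r) 0) ^ α) := by
        rw [mul_add, ← Real.mul_rpow ht.le (by positivity), ← Real.mul_rpow ht.le (by positivity),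
          mul_max_of_nonneg _ _ ht.le, mul_max_of_nonneg _ _ ht.le, mul_zero]
        have b1 : t * (1 + k * r) = t + r * |s| := by rw [hk]; field_simp
        have b2 : t * (1 - k * r) = t - r * |s| := by rw [hk]; field_simp
        rw [b1, b2]
        rcases abs_choice s with h | h <;> rw [h]
        rw [add_comm]; congr 4 <;> ring
      have a2 : r ^ (-1 - 2 * α) = k ^ (1 + 2 * α) * (k * r) ^ (-1 - 2 * α) := by
        rw [Real.mul_rpow hk0.le hr0.le, ← mul_assoc, ← Real.rpow_add hk0]
        ring_nf; simp
      rw [a1, a2]; ring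
    rw [e1, integral_const_mul, integral_comp_mul_left_Ioi
      (fun x : ℝ => ((max (1 + x) 0) ^ α + (max (1 - x) 0) ^ α - 2) * x ^ (-1 - 2 * α)) _ hk0,
      smul_eq_mul]
    set I := ∫ r in Ioi (k * ε), ((max (1 + r) 0) ^ α + (max (1 - r) 0) ^ α - 2) * r ^ (-1 - 2 * α)
    have h3 : t ^ α * k ^ (1 + 2 * α) * (k⁻¹ * -((k * ε) ^ (2 - 2 * α) / (2 * α))) =
        -(t ^ α * k ^ 2 * ε ^ (2 - 2 * α) / (2 * α)) := by
      rw [Real.mul_rpow hk0.le hε.le]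
      have : k ^ 2 = k ^ (1 + 2 * α) * k⁻¹ * k ^ (2 - 2 * α) := by
        rw [← Real.rpow_neg_one k, ← Real.rpow_add hk0, ← Real.rpow_add hk0, ← Real.rpow_natCast]
        push_cast; ring_nf
      rw [this]; ring
    have h4 : k ≤ t⁻¹ := by
      rw [hk, div_le_iff₀ ht, inv_mul_cancel₀ ht.ne']; exact hs
    calc -(t ^ α * t⁻¹ ^ 2 * ε ^ (2 - 2 * α) / (2 * α))
        ≤ -(t ^ α * k ^ 2 * ε ^ (2 - 2 * α) / (2 * α)) := by gcongr
      _ = _ := h3.symm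
      _ ≤ _ := by gcongr

lemma wf_lower {N : ℕ} (hN : 2 ≤ N) {α : ℝ} (h0 : 0 < α) (h1 : α < 1) (i : Fin N)
    (e : EuclideanSpace ℝ (Fin N)) (ht : 0 < e i) :
    ∃ C : ℝ, ∀ ε, 0 < ε → ε < e i → -(C * ε ^ (2 - 2 * α)) ≤
      ∫ y in {y : EuclideanSpace ℝ (Fin N) | ε < ‖y‖},
        (wf α i (e + y) - wf α i e) * ‖y‖ ^ (-((N : ℝ) + 2 * α)) := by
  obtain ⟨M, hM, hpol⟩ := polar_lower hN
  refine ⟨M * ((e i) ^ α * (e i)⁻¹ ^ 2 / (2 * α)) / 2, fun ε hε hεt => ?_⟩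
  set S : Set (EuclideanSpace ℝ (Fin N)) := {y | ε < ‖y‖} with hS
  have hm : MeasurableSet S := measurableSet_lt measurable_const measurable_norm
  set F : EuclideanSpace ℝ (Fin N) → ℝ :=
    fun y => (wf α i (e + y) - wf α i e) * ‖y‖ ^ (-((N : ℝ) + 2 * α)) with hF
  have hFi : IntegrableOn F S := by
    have a := wf_int h0 i hε e
    have b := (kernel_int (N := N) (r := N + 2 * α) (by linarith) hε).const_mul (wf α i e)
    refine (a.sub b).congr (.of_forall fun y => ?_)
    simp [hF]; ring
  have hInd : Integrable (S.indicator F) := (integrable_indicator_iff hm).2 hFi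
  have hneg : Integrable (fun y => S.indicator F (-y)) := hInd.comp_neg
  have hGi := hInd.add hneg
  have hGint : ∫ y, (S.indicator F y + S.indicator F (-y)) = 2 * ∫ y in S, F y := by
    rw [integral_add hInd hneg, integral_neg_eq_self (fun y => S.indicator F y),
      integral_indicator hm]; ring
  have := hpol (fun y => S.indicator F y + S.indicator F (-y))
    (-((e i) ^ α * (e i)⁻¹ ^ 2 * ε ^ (2 - 2 * α) / (2 * α))) hGi ?_
  · rw [hGint] at this
    have h2 : M * -((e i) ^ α * (e i)⁻¹ ^ 2 * ε ^ (2 - 2 * α) / (2 * α)) =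
      2 * -(M * ((e i) ^ α * (e i)⁻¹ ^ 2 / (2 * α)) / 2 * ε ^ (2 - 2 * α)) := by ring
    rw [h2] at this
    linarith
  · intro θ hθ
    have hs : |θ i| ≤ 1 := by rw [← hθ]; exact coord_le i θ
    refine (ray_bound h0 h1 ht hs hε hεt).trans (le_of_eq ?_)
    have : ∀ r ∈ Ioi (0 : ℝ), r ^ (N - 1) * (S.indicator F (r • θ) + S.indicator F (-(r • θ))) =
        (Ioi ε).indicator (fun r => ((max (e i + r * θ i) 0) ^ α + (max (e i - r * θ i) 0) ^ α
          - 2 * (e i) ^ α) * r ^ (-1 - 2 * α)) r := by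
      intro r hr
      have hr0 : 0 < r := hr
      have hn : ‖r • θ‖ = r := by rw [norm_smul, hθ, Real.norm_eq_abs, abs_of_pos hr0, mul_one]
      by_cases hre : ε < r
      · have m1 : r • θ ∈ S := by simp only [hS, mem_ofPred_eq, hn]; exact hre
        have m2 : -(r • θ) ∈ S := by simp only [hS, mem_ofPred_eq, norm_neg, hn]; exact hre
        rw [indicator_of_mem m1, indicator_of_mem m2, indicator_of_mem (mem_Ioi.2 hre)]
        simp only [hF, norm_neg, hn, wf]
        have p1 : r ^ (-1 - 2 * α) = r ^ (N - 1) * r ^ (-((N : ℝ) + 2 * α)) := by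
          rw [← Real.rpow_natCast r (N - 1), ← Real.rpow_add hr0, Nat.cast_sub (by omega)]
          push_cast; ring_nf
        rw [p1]
        simp only [PiLp.add_apply, PiLp.neg_apply, PiLp.smul_apply, smul_eq_mul, max_eq_left ht.le]
        rw [← sub_eq_add_neg]
        ring
      · have m1 : r • θ ∉ S := by simp only [hS, mem_ofPred_eq, hn]; exact hre
        have m2 : -(r • θ) ∉ S := by simp only [hS, mem_ofPred_eq, norm_neg, hn]; exact hre
        rw [indicator_of_notMem m1, indicator_of_notMem m2, indicator_of_notMem (by simpa using hre)]
        simp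
    rw [setIntegral_congr_fun measurableSet_Ioi this, setIntegral_indicator measurableSet_Ioi,
      Ioi_inter_Ioi, max_eq_right hε.le]

lemma shift_integral {N : ℕ} (F : EuclideanSpace ℝ (Fin N) → ℝ) (e : EuclideanSpace ℝ (Fin N))
    (ε : ℝ) : ∫ y in {y | ε < ‖y‖}, F (e + y) = ∫ z in {z | ε < ‖z - e‖}, F z := by
  have hm : MeasurableSet {y : EuclideanSpace ℝ (Fin N) | ε < ‖y‖} :=
    measurableSet_lt measurable_const measurable_norm
  have hm2 : MeasurableSet {z : EuclideanSpace ℝ (Fin N) | ε < ‖z - e‖} :=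
    measurableSet_lt measurable_const (by fun_prop)
  rw [← integral_indicator hm, ← integral_indicator hm2,
    ← integral_add_left_eq_self (indicator {z | ε < ‖z - e‖} F) e]
  congr 1
  ext y
  simp [indicator]

lemma shift_integrable {N : ℕ} (F : EuclideanSpace ℝ (Fin N) → ℝ) (e : EuclideanSpace ℝ (Fin N))
    (ε : ℝ) : IntegrableOn (fun y => F (e + y)) {y | ε < ‖y‖} ↔
      IntegrableOn F {z | ε < ‖z - e‖} := by
  have hm : MeasurableSet {y : EuclideanSpace ℝ (Fin N) | ε < ‖y‖} :=
    measurableSet_lt measurable_const measurable_norm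
  have hm2 : MeasurableSet {z : EuclideanSpace ℝ (Fin N) | ε < ‖z - e‖} :=
    measurableSet_lt measurable_const (by fun_prop)
  rw [← integrable_indicator_iff hm, ← integrable_indicator_iff hm2]
  have : (indicator {y : EuclideanSpace ℝ (Fin N) | ε < ‖y‖} fun y => F (e + y)) =
      fun y => (indicator {z | ε < ‖z - e‖} F) (e + y) := by
    ext y; simp [indicator]
  rw [this]
  constructor
  · intro h
    have := h.comp_add_left (-e)
    simpa using this
  · intro h; exact h.comp_add_left e

lemma kernel_int' {N : ℕ} {r ε : ℝ} (hr : (N : ℝ) < r) (hε : 0 < ε)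
    (e : EuclideanSpace ℝ (Fin N)) :
    IntegrableOn (fun z : EuclideanSpace ℝ (Fin N) => ‖z - e‖ ^ (-r)) {z | ε < ‖z - e‖} := by
  rw [← shift_integrable]
  simpa using kernel_int hr hε

/-- Integrability of a function with a mild singularity at the origin. -/
lemma sing_int {N : ℕ} (hN : 2 ≤ N) {γ p ε : ℝ} (h0 : 0 ≤ γ) (hγ : γ < N) (hp : (N : ℝ) < p)
    (hε : 0 < ε) (e : EuclideanSpace ℝ (Fin N)) (g : EuclideanSpace ℝ (Fin N) → ℝ)
    (hg : Measurable g) (hb : ∀ z, |g z| ≤ ‖z‖ ^ (-γ)) :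
    IntegrableOn (fun z => g z * ‖z - e‖ ^ (-p)) {z | ε < ‖z - e‖} := by
  have hm2 : MeasurableSet {z : EuclideanSpace ℝ (Fin N) | ε < ‖z - e‖} :=
    measurableSet_lt measurable_const (by fun_prop)
  have hp0 : 0 < p := lt_of_le_of_lt (Nat.cast_nonneg N) hp
  have hmeas : Measurable (fun z : EuclideanSpace ℝ (Fin N) => g z * ‖z - e‖ ^ (-p)) := by
    fun_prop
  have h1 : Integrable ((Metric.ball (0 : EuclideanSpace ℝ (Fin N)) 2).indicator
      fun z => ‖z‖ ^ (-γ)) :=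
    (integrable_indicator_iff measurableSet_ball).2 (origin_int hN hγ)
  have h2 := ((h1.const_mul (ε ^ (-p))).integrableOn (s := {z | ε < ‖z - e‖})).add
    (kernel_int' hp hε e)
  refine Integrable.mono' h2 hmeas.aestronglyMeasurable ?_
  refine (ae_restrict_mem hm2).mono fun z hz => ?_
  have hz' : ε < ‖z - e‖ := hz
  have hz0 : 0 < ‖z - e‖ := hε.trans hz'
  rw [norm_mul, Real.norm_eq_abs, Real.norm_eq_abs, abs_of_pos (Real.rpow_pos_of_pos hz0 _)]
  simp only [Pi.add_apply]
  by_cases hzb : z ∈ Metric.ball (0 : EuclideanSpace ℝ (Fin N)) 2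
  · rw [indicator_of_mem hzb]
    have a : ‖z - e‖ ^ (-p) ≤ ε ^ (-p) :=
      Real.rpow_le_rpow_of_nonpos hε hz'.le (by linarith)
    have b : 0 ≤ ‖z - e‖ ^ (-p) := by positivity
    have c : |g z| * ‖z - e‖ ^ (-p) ≤ ‖z‖ ^ (-γ) * ε ^ (-p) :=
      mul_le_mul (hb z) a b (by positivity)
    linarith
  · rw [indicator_of_notMem hzb]
    have hz2 : 2 ≤ ‖z‖ := by simpa using hzb
    have a : ‖z‖ ^ (-γ) ≤ 1 := Real.rpow_le_one_of_one_le_of_nonpos (by linarith) (by linarith)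
    have b : 0 ≤ ‖z - e‖ ^ (-p) := by positivity
    have c := hb z
    nlinarith

/-- The antisymmetric difference between the barrier and its Kelvin transform. -/
noncomputable def ff {N : ℕ} (α : ℝ) (i : Fin N) (z : EuclideanSpace ℝ (Fin N)) : ℝ :=
  wf α i z * (‖z‖ ^ (-(N : ℝ)) - 1)

lemma kelvin_zero {N : ℕ} {α : ℝ} (i : Fin N)
    (e : EuclideanSpace ℝ (Fin N)) (he : ‖e‖ = 1) (ε : ℝ) :
    ∫ z in {z : EuclideanSpace ℝ (Fin N) | z ≠ 0 ∧ ε * √‖z‖ < ‖z - e‖},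
      ff α i z * ‖z - e‖ ^ (-((N : ℝ) + 2 * α)) = 0 := by
  set s : Set (EuclideanSpace ℝ (Fin N)) := {z | z ≠ 0 ∧ ε * √‖z‖ < ‖z - e‖} with hs
  set T : EuclideanSpace ℝ (Fin N) → EuclideanSpace ℝ (Fin N) := inversion 0 1 with hT
  have he0 : e ≠ 0 := by rintro rfl; simp at he
  have hTe : T e = e := inversion_of_mem_sphere (by simpa using he)
  have hTn : ∀ x, ‖T x‖ = ‖x‖⁻¹ := by
    intro x
    have := dist_inversion_center 0 x 1
    simpa using this
  have hTd : ∀ x, x ≠ 0 → ‖T x - e‖ = ‖x‖⁻¹ * ‖x - e‖ := by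
    intro x hx
    have := dist_inversion_inversion hx he0 (1 : ℝ)
    rw [← hT, hTe] at this
    simpa [dist_eq_norm, he] using this
  have hTT : ∀ x, T (T x) = x := inversion_inversion 0 one_ne_zero
  have hT0 : ∀ x, x ≠ 0 → T x ≠ 0 := fun x hx h => hx ((inversion_eq_center one_ne_zero).1 h)
  have hTs : ∀ x ∈ s, T x ∈ s := by
    rintro x ⟨hx, hx2⟩
    refine ⟨hT0 x hx, ?_⟩
    rw [hTn, hTd x hx]
    have hn : 0 < ‖x‖ := norm_pos_iff.2 hx
    have : ε * √(‖x‖⁻¹) = ‖x‖⁻¹ * (ε * √‖x‖) := by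
      rw [Real.sqrt_inv]
      have h1 : √‖x‖ * √‖x‖ = ‖x‖ := Real.mul_self_sqrt hn.le
      have h2 : 0 < √‖x‖ := Real.sqrt_pos.2 hn
      field_simp
      rw [pow_two, h1]
    rw [this]
    gcongr
  have him : T '' s = s := by
    apply subset_antisymm
    · rintro _ ⟨x, hx, rfl⟩; exact hTs x hx
    · intro x hx; exact ⟨T x, hTs x hx, hTT x⟩
  have hms : MeasurableSet s := by
    apply MeasurableSet.inter
    · exact (measurableSet_singleton 0).compl
    · have m1 : Measurable fun z : EuclideanSpace ℝ (Fin N) => ε * √‖z‖ := by fun_prop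
      have m2 : Measurable fun z : EuclideanSpace ℝ (Fin N) => ‖z - e‖ := by fun_prop
      exact measurableSet_lt m1 m2
  have hd : ∀ x ∈ s, HasFDerivWithinAt T
      (((1 / dist x 0) ^ 2 • ((ℝ ∙ (x - 0))ᗮ.reflection :
        EuclideanSpace ℝ (Fin N) →L[ℝ] EuclideanSpace ℝ (Fin N)))) s x :=
    fun x hx => (hasFDerivAt_inversion hx.1).hasFDerivWithinAt
  have hinj : InjOn T s := (inversion_injective 0 one_ne_zero).injOn
  have key := integral_image_eq_integral_abs_det_fderiv_smul volume hms hd hinj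
    (fun z => ff α i z * ‖z - e‖ ^ (-((N : ℝ) + 2 * α)))
  rw [him] at key
  have hcong : ∀ x ∈ s, |((1 / dist x 0) ^ 2 • ((ℝ ∙ (x - 0))ᗮ.reflection :
        EuclideanSpace ℝ (Fin N) →L[ℝ] EuclideanSpace ℝ (Fin N))).det| •
        (ff α i (T x) * ‖T x - e‖ ^ (-((N : ℝ) + 2 * α))) =
      -(ff α i x * ‖x - e‖ ^ (-((N : ℝ) + 2 * α))) := by
    rintro x ⟨hx, -⟩
    have hn : 0 < ‖x‖ := norm_pos_iff.2 hx
    have hdet : |((1 / dist x 0) ^ 2 • ((ℝ ∙ (x - 0))ᗮ.reflection :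
        EuclideanSpace ℝ (Fin N) →L[ℝ] EuclideanSpace ℝ (Fin N))).det| = ‖x‖ ^ (-(2 * N : ℝ)) := by
      have h1 : |(((ℝ ∙ (x - 0))ᗮ.reflection :
        EuclideanSpace ℝ (Fin N) →L[ℝ] EuclideanSpace ℝ (Fin N))).det| = 1 := by
        have := (ℝ ∙ (x - 0))ᗮ.det_reflection
        have h2 : (((ℝ ∙ (x - 0))ᗮ.reflection :
          EuclideanSpace ℝ (Fin N) →L[ℝ] EuclideanSpace ℝ (Fin N))).det =
          LinearMap.det (ℝ ∙ (x - 0))ᗮ.reflection.toLinearMap := rfl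
        rw [h2, this]; simp
      have h3 : ∀ (c : ℝ) (L : EuclideanSpace ℝ (Fin N) →L[ℝ] EuclideanSpace ℝ (Fin N)),
          (c • L).det = c ^ N * L.det := by
        intro c L
        simp [ContinuousLinearMap.det]
      rw [h3, abs_mul, h1, mul_one, abs_of_nonneg (by positivity), dist_zero_right,
        Real.rpow_neg hn.le, one_div, inv_pow, inv_pow, ← pow_mul, ← Real.rpow_natCast]
      push_cast; rfl
    have hw : wf α i (T x) = wf α i x * ‖x‖ ^ (-(2 * α)) := by
      have : T x i = ‖x‖⁻¹ ^ 2 * x i := by simp [hT, inversion]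
      unfold wf
      rw [this]
      have h2 : max (‖x‖⁻¹ ^ 2 * x i) 0 = ‖x‖⁻¹ ^ 2 * max (x i) 0 := by
        rw [mul_max_of_nonneg _ _ (by positivity), mul_zero]
      rw [h2, Real.mul_rpow (by positivity) (by positivity), mul_comm]
      congr 1
      rw [inv_pow, Real.inv_rpow (by positivity), ← Real.rpow_natCast, ← Real.rpow_mul hn.le,
        ← Real.rpow_neg hn.le]
      push_cast; rfl
    rw [hdet, smul_eq_mul, hTd x hx]
    unfold ff
    rw [hw, hTn, Real.mul_rpow (by positivity) (by positivity), Real.inv_rpow hn.le,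
      Real.inv_rpow hn.le, ← Real.rpow_neg hn.le, ← Real.rpow_neg hn.le, neg_neg, neg_neg]
    have a1 : ‖x‖ ^ (-(2 * N : ℝ)) * ‖x‖ ^ (-(2 * α)) * ‖x‖ ^ ((N : ℝ) + 2 * α) = ‖x‖ ^ (-(N : ℝ)) := by
      rw [← Real.rpow_add hn, ← Real.rpow_add hn]; ring_nf
    have a2 : ‖x‖ ^ (-(N : ℝ)) * ‖x‖ ^ (N : ℝ) = 1 := by
      rw [← Real.rpow_add hn]; simp
    calc _ = wf α i x * ((‖x‖ ^ (-(2 * N : ℝ)) * ‖x‖ ^ (-(2 * α)) * ‖x‖ ^ ((N : ℝ) + 2 * α)) *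
          (‖x‖ ^ (N : ℝ) - 1)) * ‖x - e‖ ^ (-((N : ℝ) + 2 * α)) := by ring
      _ = _ := by rw [a1, mul_sub, a2]; ring
  rw [setIntegral_congr_fun hms hcong, integral_neg] at key
  linarith

/-- The barrier `(z_i)_+ ^ α |z| ^ (-N)`. -/
noncomputable def hf {N : ℕ} (α : ℝ) (i : Fin N) (z : EuclideanSpace ℝ (Fin N)) : ℝ :=
  wf α i z * ‖z‖ ^ (-(N : ℝ))

lemma hf_nonneg {N : ℕ} (α : ℝ) (i : Fin N) (z : EuclideanSpace ℝ (Fin N)) : 0 ≤ hf α i z :=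
  mul_nonneg (wf_nonneg _ _ _) (by positivity)

lemma hf_le {N : ℕ} {α : ℝ} (h0 : 0 < α) (i : Fin N) (z : EuclideanSpace ℝ (Fin N)) :
    hf α i z ≤ ‖z‖ ^ (-((N : ℝ) - α)) := by
  unfold hf
  rcases eq_or_ne z 0 with rfl | hz
  · have : wf α i 0 = 0 := by simp [wf, h0.ne']
    rw [this]; simp; positivity
  · have hn : 0 < ‖z‖ := norm_pos_iff.2 hz
    have : ‖z‖ ^ (-((N : ℝ) - α)) = ‖z‖ ^ α * ‖z‖ ^ (-(N : ℝ)) := by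
      rw [← Real.rpow_add hn]; ring_nf
    rw [this]
    have := wf_le h0 i z
    gcongr

lemma hf_meas {N : ℕ} {α : ℝ} (h0 : 0 < α) (i : Fin N) : Measurable (hf (N := N) α i) := by
  have := (wf_cont h0 i).measurable
  unfold hf
  fun_prop

lemma rpow_lip (N : ℕ) : ∃ L ρ : ℝ, 0 < L ∧ 0 < ρ ∧ ∀ r : ℝ, |r - 1| < ρ →
    |r ^ (-(N : ℝ)) - 1| ≤ L * |r - 1| := by
  have hd : HasDerivAt (fun r : ℝ => r ^ (-(N : ℝ))) (-(N : ℝ) * 1 ^ (-(N : ℝ) - 1)) 1 :=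
    Real.hasDerivAt_rpow_const (Or.inl one_ne_zero)
  have hO := hd.isBigO_sub
  obtain ⟨L, hL0, hL⟩ := hO.exists_pos
  have hL' := hL.bound
  obtain ⟨ρ, hρ, h⟩ := Metric.eventually_nhds_iff.1 hL'
  refine ⟨L, ρ, hL0, hρ, fun r hr => ?_⟩
  have := h (y := r) (by simpa [Real.dist_eq] using hr)
  simpa using this

lemma shell_volume (N : ℕ) (e : EuclideanSpace ℝ (Fin N)) (hN : 2 ≤ N) :
    ∃ C : ℝ, 0 ≤ C ∧ ∀ ε : ℝ, 0 < ε → ε < 1 / 2 →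
      volume.real {z : EuclideanSpace ℝ (Fin N) | ε / (1 + ε) ≤ ‖z - e‖ ∧ ‖z - e‖ ≤ ε / (1 - ε)}
        ≤ C * ε ^ (N + 1) := by
  have : Nonempty (Fin N) := ⟨⟨0, by omega⟩⟩
  have : Nontrivial (EuclideanSpace ℝ (Fin N)) := inferInstance
  set W := volume.real (Metric.ball (0 : EuclideanSpace ℝ (Fin N)) 1) with hW
  refine ⟨2 * N * 2 ^ N * W, by positivity, fun ε hε hε2 => ?_⟩
  set a := ε / (1 - ε) with ha
  set b := ε / (1 + ε) with hb
  have h1ε : 0 < 1 - ε := by linarith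
  have ha0 : 0 < a := by positivity
  have hb0 : 0 < b := by positivity
  have hba : b ≤ a := by rw [ha, hb]; gcongr; linarith
  have hset : {z : EuclideanSpace ℝ (Fin N) | b ≤ ‖z - e‖ ∧ ‖z - e‖ ≤ a} =
      Metric.closedBall e a \ Metric.ball e b := by
    ext z; simp [dist_eq_norm, and_comm]
  have hsub : Metric.ball e b ⊆ Metric.closedBall e a :=
    Metric.ball_subset_closedBall.trans (Metric.closedBall_subset_closedBall hba)
  rw [hset, measureReal_sdiff hsub measurableSet_ball measure_closedBall_lt_top.ne]
  have v1 : volume.real (Metric.closedBall e a) = a ^ N * W := by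
    rw [Measure.addHaar_real_closedBall _ _ ha0.le]; simp [hW]
  have v2 : volume.real (Metric.ball e b) = b ^ N * W := by
    rw [← Measure.addHaar_real_closedBall_eq_addHaar_real_ball, Measure.addHaar_real_closedBall _ _ hb0.le]; simp [hW]
  rw [v1, v2]
  have hW0 : 0 ≤ W := by positivity
  have hbern : 1 + (N : ℝ) * (b / a - 1) ≤ (b / a) ^ N := by
    have := one_add_mul_le_pow (a := b / a - 1) (by have : 0 < b / a := by positivity
                                                    linarith) N
    simpa using this
  have hq : 1 - b / a ≤ 2 * ε := by
    have : b / a = (1 - ε) / (1 + ε) := by rw [ha, hb]; field_simp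
    rw [this, sub_le_iff_le_add, ← sub_le_iff_le_add', le_div_iff₀ (by positivity)]
    nlinarith
  have ha2 : a ≤ 2 * ε := by rw [ha, div_le_iff₀ h1ε]; nlinarith
  have hbN : b ^ N = a ^ N * (b / a) ^ N := by rw [← mul_pow]; congr 1; field_simp
  have h3 : a ^ N - b ^ N ≤ a ^ N * (N * (2 * ε)) := by
    rw [hbN]
    have : 1 - (b / a) ^ N ≤ N * (2 * ε) := by
      have : (N : ℝ) * (1 - b / a) ≤ N * (2 * ε) := by gcongr
      linarith
    have h4 : 0 ≤ a ^ N := by positivity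
    nlinarith
  have h5 : a ^ N ≤ 2 ^ N * ε ^ N := by rw [← mul_pow]; gcongr
  calc a ^ N * W - b ^ N * W = (a ^ N - b ^ N) * W := by ring
    _ ≤ (a ^ N * (N * (2 * ε))) * W := by gcongr
    _ ≤ ((2 ^ N * ε ^ N) * (N * (2 * ε))) * W := by gcongr
    _ = _ := by ring

lemma hf_int {N : ℕ} (hN : 2 ≤ N) {α ε : ℝ} (h0 : 0 < α) (h1 : α < 1) (i : Fin N)
    (hε : 0 < ε) (e : EuclideanSpace ℝ (Fin N)) :
    IntegrableOn (fun z => hf α i z * ‖z - e‖ ^ (-((N : ℝ) + 2 * α))) {z | ε < ‖z - e‖} := by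
  have hN' : (2 : ℝ) ≤ N := by exact_mod_cast hN
  refine sing_int hN (γ := N - α) (by linarith) (by linarith) (by linarith) hε e _ (hf_meas h0 i) ?_
  intro z
  rw [abs_of_nonneg (hf_nonneg _ _ _)]
  exact hf_le h0 i z

lemma wf_int' {N : ℕ} {α ε : ℝ} (h0 : 0 < α) (i : Fin N) (hε : 0 < ε)
    (e : EuclideanSpace ℝ (Fin N)) :
    IntegrableOn (fun z => wf α i z * ‖z - e‖ ^ (-((N : ℝ) + 2 * α))) {z | ε < ‖z - e‖} := by
  rw [← shift_integrable]
  simpa using wf_int h0 i hε e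

lemma ff_int {N : ℕ} (hN : 2 ≤ N) {α ε : ℝ} (h0 : 0 < α) (h1 : α < 1) (i : Fin N)
    (hε : 0 < ε) (e : EuclideanSpace ℝ (Fin N)) :
    IntegrableOn (fun z => ff α i z * ‖z - e‖ ^ (-((N : ℝ) + 2 * α))) {z | ε < ‖z - e‖} := by
  refine ((hf_int hN h0 h1 i hε e).sub (wf_int' h0 i hε e)).congr (.of_forall fun z => ?_)
  simp [hf, ff]; ring

lemma ff_lower {N : ℕ} (hN : 2 ≤ N) {α : ℝ} (h0 : 0 < α) (h1 : α < 1) (i : Fin N)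
    (e : EuclideanSpace ℝ (Fin N)) (he : ‖e‖ = 1) :
    ∃ C ε₀ : ℝ, 0 < ε₀ ∧ ∀ ε, 0 < ε → ε < ε₀ → -(C * ε ^ (2 - 2 * α)) ≤
      ∫ z in {z : EuclideanSpace ℝ (Fin N) | ε < ‖z - e‖},
        ff α i z * ‖z - e‖ ^ (-((N : ℝ) + 2 * α)) := by
  have hN' : (2 : ℝ) ≤ N := by exact_mod_cast hN
  obtain ⟨L, ρ, hL, hρ, hlip⟩ := rpow_lip N
  obtain ⟨V, hV0, hV⟩ := shell_volume N e hN
  set p : ℝ := (N : ℝ) + 2 * α with hp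
  refine ⟨2 * (2 * L * 2⁻¹ ^ (1 - p) * V), min (ρ / 2) (1 / 2), by positivity, fun ε hε hε0 => ?_⟩
  have hε2 : ε < 1 / 2 := hε0.trans_le (min_le_right _ _)
  have hερ : ε < ρ / 2 := hε0.trans_le (min_le_left _ _)
  have h1ε : 0 < 1 - ε := by linarith
  set a := ε / (1 - ε) with ha
  set b := ε / (1 + ε) with hb
  have ha0 : 0 < a := by positivity
  have hb0 : 0 < b := by positivity
  have ha2 : a ≤ 2 * ε := by rw [ha, div_le_iff₀ h1ε]; nlinarith
  have hb2 : 2⁻¹ * ε ≤ b := by rw [hb, le_div_iff₀ (by positivity)]; nlinarith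
  have hbe : b ≤ ε := by apply div_le_self hε.le; linarith
  have hea : ε ≤ a := by rw [ha, le_div_iff₀ h1ε]; nlinarith
  set F : EuclideanSpace ℝ (Fin N) → ℝ := fun z => ff α i z * ‖z - e‖ ^ (-p) with hF
  set A : Set (EuclideanSpace ℝ (Fin N)) := {z | b ≤ ‖z - e‖ ∧ ‖z - e‖ ≤ a} with hA
  set B : Set (EuclideanSpace ℝ (Fin N)) := {z | ε < ‖z - e‖} with hB
  set Dc : Set (EuclideanSpace ℝ (Fin N)) := {z | z ≠ 0 ∧ ε * √‖z‖ < ‖z - e‖} with hDc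
  set Big : Set (EuclideanSpace ℝ (Fin N)) := {z | z ≠ 0 ∧ a < ‖z - e‖} with hBig
  have mn : Measurable fun z : EuclideanSpace ℝ (Fin N) => ‖z - e‖ := by fun_prop
  have ms : Measurable fun z : EuclideanSpace ℝ (Fin N) => ε * √‖z‖ := by fun_prop
  have m0 : MeasurableSet {z : EuclideanSpace ℝ (Fin N) | z ≠ 0} :=
    (measurableSet_singleton 0).compl
  have mA : MeasurableSet A :=
    (measurableSet_le measurable_const mn).inter (measurableSet_le mn measurable_const)
  have mB : MeasurableSet B := measurableSet_lt measurable_const mn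
  have mD : MeasurableSet Dc := m0.inter (measurableSet_lt ms mn)
  have mBig : MeasurableSet Big := m0.inter (measurableSet_lt measurable_const mn)
  have hFi : IntegrableOn F {z | b / 2 < ‖z - e‖} := ff_int hN h0 h1 i (by positivity) e
  have htri : ∀ z : EuclideanSpace ℝ (Fin N), |‖z‖ - 1| ≤ ‖z - e‖ := by
    intro z; rw [← he]; exact abs_norm_sub_norm_le z e
  have hAvol : volume A ≠ ⊤ := by
    refine ((measure_mono (?_ : A ⊆ Metric.closedBall e a)).trans_lt
      measure_closedBall_lt_top).ne
    intro z hz; simpa [dist_eq_norm] using hz.2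
  have split : ∀ X : Set (EuclideanSpace ℝ (Fin N)), MeasurableSet X → Big ⊆ X →
      (∀ z ∈ X, z ∉ Big → z ∈ A) →
      ∃ I : ℝ, |I| ≤ 2 * L * 2⁻¹ ^ (1 - p) * V * ε ^ (2 - 2 * α) ∧
        ∫ z in X, F z = (∫ z in Big, F z) + I := by
    intro X mX hX hXA
    have hdA : X \ Big ⊆ A := fun z hz => hXA z hz.1 hz.2
    have hBigI : IntegrableOn F Big := hFi.mono_set (by
      rintro z ⟨-, hz⟩
      have hz' : a < ‖z - e‖ := hz
      show b / 2 < ‖z - e‖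
      linarith)
    have hdI : IntegrableOn F (X \ Big) := hFi.mono_set (by
      intro z hz
      have hz' := (hdA hz).1
      show b / 2 < ‖z - e‖
      linarith)
    refine ⟨∫ z in X \ Big, F z, ?_, ?_⟩
    · have hbd : ∀ z ∈ X \ Big, ‖F z‖ ≤ 2 * L * 2⁻¹ ^ (1 - p) * ε ^ (1 - p) := by
        intro z hz
        obtain ⟨hz1, hz2⟩ := hdA hz
        have hd0 : 0 < ‖z - e‖ := hb0.trans_le hz1
        have ht := htri z
        have hl := hlip ‖z‖ (by linarith)
        have hz3 : ‖z‖ ≤ 2 := by have := (abs_le.1 ht).2; linarith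
        have hw : wf α i z ≤ 2 := by
          refine (wf_le h0 i z).trans ?_
          calc ‖z‖ ^ α ≤ 2 ^ α := by gcongr
            _ ≤ 2 ^ (1 : ℝ) := by
              apply Real.rpow_le_rpow_of_exponent_le <;> linarith
            _ = 2 := by simp
        have hw0 := wf_nonneg α i z
        simp only [hF, ff]
        rw [norm_mul, norm_mul, Real.norm_eq_abs, Real.norm_eq_abs, Real.norm_eq_abs,
          abs_of_nonneg hw0, abs_of_pos (Real.rpow_pos_of_pos hd0 _)]
        have e1 : ‖z - e‖ ^ (1 - p) = ‖z - e‖ * ‖z - e‖ ^ (-p) := by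
          nth_rewrite 2 [← Real.rpow_one ‖z - e‖]
          rw [← Real.rpow_add hd0]; ring_nf
        calc wf α i z * |‖z‖ ^ (-(N : ℝ)) - 1| * ‖z - e‖ ^ (-p)
            ≤ 2 * (L * ‖z - e‖) * ‖z - e‖ ^ (-p) := by
              gcongr
              exact hl.trans (by gcongr)
          _ = 2 * L * ‖z - e‖ ^ (1 - p) := by rw [e1]; ring
          _ ≤ 2 * L * (2⁻¹ * ε) ^ (1 - p) := by
              gcongr 2 * L * ?_
              exact Real.rpow_le_rpow_of_nonpos (by positivity) (hb2.trans hz1) (by linarith)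
          _ = _ := by rw [Real.mul_rpow (by positivity) hε.le]; ring
      have hvol : volume (X \ Big) < ⊤ := (measure_mono hdA).trans_lt hAvol.lt_top
      have h := norm_setIntegral_le_of_norm_le_const hvol hbd
      rw [Real.norm_eq_abs] at h
      refine h.trans ?_
      have hv : volume.real (X \ Big) ≤ V * ε ^ (N + 1) :=
        (measureReal_mono hdA hAvol).trans (hV ε hε hε2)
      calc 2 * L * 2⁻¹ ^ (1 - p) * ε ^ (1 - p) * volume.real (X \ Big)
          ≤ 2 * L * 2⁻¹ ^ (1 - p) * ε ^ (1 - p) * (V * ε ^ (N + 1)) := by gcongr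
        _ = 2 * L * 2⁻¹ ^ (1 - p) * V * (ε ^ (1 - p) * ε ^ (N + 1)) := by ring
        _ = _ := by
            congr 1
            rw [← Real.rpow_natCast, ← Real.rpow_add hε, hp]
            push_cast; ring_nf
    · rw [← setIntegral_union disjoint_sdiff_right (mX.diff mBig) hBigI hdI,
        union_sdiff_cancel hX]
  obtain ⟨I1, hI1, hE1⟩ := split (B ∩ {z | z ≠ 0}) (mB.inter m0) (by
      rintro z ⟨hz0, hz⟩
      exact ⟨lt_of_le_of_lt hea hz, hz0⟩) (by
      rintro z ⟨hz, hz0⟩ hzb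
      have hz' : ε < ‖z - e‖ := hz
      refine ⟨by linarith, ?_⟩
      by_contra hcon
      exact hzb ⟨hz0, not_le.1 hcon⟩)
  obtain ⟨I2, hI2, hE2⟩ := split Dc mD (by
      rintro z ⟨hz0, hz⟩
      refine ⟨hz0, ?_⟩
      have hz' : a < ‖z - e‖ := hz
      have ht := (abs_le.1 (htri z)).2
      have hd : 0 ≤ ‖z - e‖ := norm_nonneg _
      have hs : √‖z‖ ≤ 1 + ‖z - e‖ := by
        rw [Real.sqrt_le_left (by linarith)]
        nlinarith
      have : ε < ‖z - e‖ * (1 - ε) := by rwa [ha, div_lt_iff₀ h1ε] at hz'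
      nlinarith) (by
      rintro z ⟨hz0, hz⟩ hzb
      have hza : ‖z - e‖ ≤ a := by
        by_contra hcon
        exact hzb ⟨hz0, not_le.1 hcon⟩
      refine ⟨?_, hza⟩
      have ht := (abs_le.1 (htri z)).1
      have hz1 : ‖z - e‖ < 1 := by linarith
      have hd : 0 ≤ ‖z - e‖ := norm_nonneg _
      have hs : 1 - ‖z - e‖ ≤ √‖z‖ := by
        apply Real.le_sqrt_of_sq_le
        nlinarith
      rw [hb, div_le_iff₀ (by positivity)]
      nlinarith)
  have hk := kelvin_zero (α := α) i e he ε
  rw [← hp] at hk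
  change ∫ z in Dc, F z = 0 at hk
  have hB' : ∫ z in B, F z = ∫ z in B ∩ {z | z ≠ 0}, F z := by
    apply setIntegral_congr_set
    have : ∀ᵐ z : EuclideanSpace ℝ (Fin N), z ≠ 0 := by
      have : Nonempty (Fin N) := ⟨i⟩
      have : Nontrivial (EuclideanSpace ℝ (Fin N)) := inferInstance
      exact compl_mem_ae_iff.2 (measure_singleton 0)
    filter_upwards [this] with z hz
    apply propext
    exact ⟨fun h => ⟨h, hz⟩, fun h => h.1⟩
  rw [hB']
  have := abs_le.1 hI1
  have := abs_le.1 hI2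
  linarith

lemma hf_lower {N : ℕ} (hN : 2 ≤ N) {α : ℝ} (h0 : 0 < α) (h1 : α < 1) (i : Fin N)
    (e : EuclideanSpace ℝ (Fin N)) (he : ‖e‖ = 1) (ht : 0 < e i) :
    ∃ C ε₀ : ℝ, 0 < ε₀ ∧ ∀ ε, 0 < ε → ε < ε₀ → -(C * ε ^ (2 - 2 * α)) ≤
      ∫ z in {z : EuclideanSpace ℝ (Fin N) | ε < ‖z - e‖},
        (hf α i z - hf α i e) * ‖z - e‖ ^ (-((N : ℝ) + 2 * α)) := by
  obtain ⟨C1, hC1⟩ := wf_lower hN h0 h1 i e ht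
  obtain ⟨C2, ε₀, hε₀, hC2⟩ := ff_lower hN h0 h1 i e he
  refine ⟨C1 + C2, min ε₀ (e i), by positivity, fun ε hε hε0 => ?_⟩
  have a1 := hC1 ε hε (hε0.trans_le (min_le_right _ _))
  have a2 := hC2 ε hε (hε0.trans_le (min_le_left _ _))
  have e1 : ∫ y in {y : EuclideanSpace ℝ (Fin N) | ε < ‖y‖},
        (wf α i (e + y) - wf α i e) * ‖y‖ ^ (-((N : ℝ) + 2 * α)) =
      ∫ z in {z : EuclideanSpace ℝ (Fin N) | ε < ‖z - e‖},
        (wf α i z - wf α i e) * ‖z - e‖ ^ (-((N : ℝ) + 2 * α)) := by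
    rw [← shift_integral]; simp
  rw [e1] at a1
  have hhe : hf α i e = wf α i e := by simp [hf, he]
  have i1 : IntegrableOn (fun z => (wf α i z - wf α i e) * ‖z - e‖ ^ (-((N : ℝ) + 2 * α)))
      {z | ε < ‖z - e‖} := by
    refine ((wf_int' h0 i hε e).sub ((kernel_int' (r := N + 2 * α) (by linarith) hε e).const_mul
      (wf α i e))).congr (.of_forall fun z => ?_)
    simp; ring
  have i2 := ff_int hN h0 h1 i hε e
  have e2 : ∫ z in {z : EuclideanSpace ℝ (Fin N) | ε < ‖z - e‖},
        (hf α i z - hf α i e) * ‖z - e‖ ^ (-((N : ℝ) + 2 * α)) =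
      (∫ z in {z : EuclideanSpace ℝ (Fin N) | ε < ‖z - e‖},
        (wf α i z - wf α i e) * ‖z - e‖ ^ (-((N : ℝ) + 2 * α))) +
      ∫ z in {z : EuclideanSpace ℝ (Fin N) | ε < ‖z - e‖},
        ff α i z * ‖z - e‖ ^ (-((N : ℝ) + 2 * α)) := by
    rw [← integral_add i1 i2]
    congr 1; ext z
    rw [hhe]; simp only [hf, ff]; ring
  rw [e2]
  linarith

lemma breg_nonneg {q a b : ℝ} (hq : 1 < q) (ha : 0 ≤ a) (hb : 0 ≤ b) :
    0 ≤ a ^ q - b ^ q - q * b ^ (q - 1) * (a - b) := by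
  rcases hb.eq_or_lt with rfl | hb
  · rw [Real.zero_rpow (by linarith), Real.zero_rpow (by linarith)]
    have : 0 ≤ a ^ q := by positivity
    linarith
  · have h := one_add_mul_self_le_rpow_one_add (s := a / b - 1) (p := q)
      (by have : 0 ≤ a / b := by positivity
          linarith) hq.le
    have h1 : (1 + (a / b - 1)) = a / b := by ring
    rw [h1, Real.div_rpow ha hb.le, le_div_iff₀ (by positivity)] at h
    have h2 : b ^ (q - 1) = b ^ q / b := by rw [Real.rpow_sub_one hb.ne']
    have h3 : (1 + q * (a / b - 1)) * b ^ q = b ^ q + q * (b ^ q / b) * (a - b) := by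
      field_simp
    rw [h2]; linarith

lemma breg_lower {q a b : ℝ} (hq : 1 < q) (ha : 2 ≤ a) (hb : 0 ≤ b) (hb1 : b ≤ 1) :
    2 ^ q - 1 - q ≤ a ^ q - b ^ q - q * b ^ (q - 1) * (a - b) := by
  have h1 := breg_nonneg hq (zero_le_one) hb
  have h2 := breg_nonneg hq (a := a) (b := 2) (by linarith) (by norm_num)
  have h3 : b ^ (q - 1) ≤ 1 := Real.rpow_le_one hb hb1 (by linarith)
  have h4 : (1 : ℝ) ≤ 2 ^ (q - 1) := Real.one_le_rpow (by norm_num) (by linarith)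
  have h5 : b ^ (q - 1) * b = b ^ q := by
    rcases hb.eq_or_lt with rfl | hb
    · rw [Real.zero_rpow (by linarith : q ≠ 0)]; simp
    · rw [← Real.rpow_add_one hb.ne']; congr 1; ring
  rw [Real.one_rpow] at h1
  have h6 : 0 ≤ q * (1 - b ^ (q - 1)) * (a - 1) :=
    mul_nonneg (mul_nonneg (by linarith) (by linarith)) (by linarith)
  have h7 : 0 ≤ q * (2 ^ (q - 1) - 1) * (a - 2) :=
    mul_nonneg (mul_nonneg (by linarith) (by linarith)) (by linarith)
  nlinarith

/-- The strict subsolution `((z_i)_+ ^ α |z| ^ (-N)) ^ q`. -/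
noncomputable def vf {N : ℕ} (α q : ℝ) (i : Fin N) (z : EuclideanSpace ℝ (Fin N)) : ℝ :=
  hf α i z ^ q

lemma vf_nonneg {N : ℕ} (α q : ℝ) (i : Fin N) (z : EuclideanSpace ℝ (Fin N)) : 0 ≤ vf α q i z :=
  Real.rpow_nonneg (hf_nonneg _ _ _) _

lemma vf_le {N : ℕ} {α β q : ℝ} (h0 : 0 < α) (hq0 : 0 ≤ q) (hq : ((N : ℝ) - α) * q = β)
    (i : Fin N) (z : EuclideanSpace ℝ (Fin N)) : vf α q i z ≤ ‖z‖ ^ (-β) := by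
  unfold vf
  have := Real.rpow_le_rpow (hf_nonneg α i z) (hf_le h0 i z) hq0
  rwa [← Real.rpow_mul (norm_nonneg _), neg_mul, hq] at this

lemma vf_meas {N : ℕ} {α : ℝ} (h0 : 0 < α) (q : ℝ) (i : Fin N) :
    Measurable (vf (N := N) α q i) := by
  have := hf_meas h0 i
  unfold vf
  fun_prop

lemma hf_smul {N : ℕ} {α : ℝ} (i : Fin N) {R : ℝ} (hR : 0 < R)
    (z : EuclideanSpace ℝ (Fin N)) : hf α i (R • z) = R ^ (-((N : ℝ) - α)) * hf α i z := by
  unfold hf wf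
  have h1 : max ((R • z) i) 0 = R * max (z i) 0 := by
    rw [mul_max_of_nonneg _ _ hR.le]; simp
  rw [h1, Real.mul_rpow hR.le (le_max_right _ _), norm_smul, Real.norm_of_nonneg hR.le,
    Real.mul_rpow hR.le (norm_nonneg _)]
  have : R ^ (-((N : ℝ) - α)) = R ^ α * R ^ (-(N : ℝ)) := by
    rw [← Real.rpow_add hR]; congr 1; ring
  rw [this]; ring

lemma vf_smul {N : ℕ} {α β q : ℝ} (hq : ((N : ℝ) - α) * q = β) (i : Fin N) {R : ℝ} (hR : 0 < R)
    (z : EuclideanSpace ℝ (Fin N)) : vf α q i (R • z) = R ^ (-β) * vf α q i z := by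
  unfold vf
  rw [hf_smul i hR, Real.mul_rpow (by positivity) (hf_nonneg _ _ _), ← Real.rpow_mul hR.le,
    neg_mul, hq]

lemma vf_int {N : ℕ} (hN : 2 ≤ N) {α β q ε : ℝ} (h0 : 0 < α)
    (hq0 : 0 ≤ q) (hq : ((N : ℝ) - α) * q = β) (hβ0 : 0 ≤ β) (hβ : β < N) (i : Fin N)
    (hε : 0 < ε) (e : EuclideanSpace ℝ (Fin N)) :
    IntegrableOn (fun z => vf α q i z * ‖z - e‖ ^ (-((N : ℝ) + 2 * α))) {z | ε < ‖z - e‖} := by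
  refine sing_int hN (γ := β) hβ0 hβ (by linarith) hε e _ (vf_meas h0 q i) ?_
  intro z
  rw [abs_of_nonneg (vf_nonneg _ _ _ _)]
  exact vf_le h0 hq0 hq i z

lemma vf_lower {N : ℕ} (hN : 2 ≤ N) {α β q : ℝ} (h0 : 0 < α) (h1 : α < 1) (hq1 : 1 < q)
    (hq : ((N : ℝ) - α) * q = β) (hβ : β < N) (i : Fin N) :
    ∃ κ : ℝ, 0 < κ ∧ ∀ e : EuclideanSpace ℝ (Fin N), ‖e‖ = 1 → 0 < e i →
      ∃ ε₀ : ℝ, 0 < ε₀ ∧ ∀ ε, 0 < ε → ε < ε₀ → κ ≤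
      ∫ z in {z : EuclideanSpace ℝ (Fin N) | ε < ‖z - e‖},
        (vf α q i z - vf α q i e) * ‖z - e‖ ^ (-((N : ℝ) + 2 * α)) := by
  have hN' : (2 : ℝ) ≤ N := by exact_mod_cast hN
  have hβ0 : 0 ≤ β := by rw [← hq]; exact mul_nonneg (by linarith) (by linarith)
  set p := (N : ℝ) + 2 * α with hp
  set c : EuclideanSpace ℝ (Fin N) := EuclideanSpace.single i (1 / 16 : ℝ) with hc
  set G := Metric.ball c (1 / 32) with hG
  set m := (2 : ℝ) ^ q - 1 - q with hm
  have hm0 : 0 < m := by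
    have := one_add_mul_self_lt_rpow_one_add (s := 1) (p := q) (by norm_num) (by norm_num) hq1
    norm_num at this
    linarith
  have hGv : 0 < volume.real G := by
    rw [Measure.real, ENNReal.toReal_pos_iff]
    exact ⟨Metric.measure_ball_pos _ _ (by norm_num), measure_ball_lt_top⟩
  have hcn : ‖c‖ = 1 / 16 := by simp [hc]
  have hGn : ∀ z ∈ G, ‖z‖ ≤ 3 / 32 := by
    intro z hz
    have h2 : ‖z - c‖ < 1 / 32 := by simpa [hG, dist_eq_norm] using hz
    have := norm_add_le (z - c) c
    rw [sub_add_cancel, hcn] at this; linarith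
  have hGh : ∀ z ∈ G, 2 ≤ hf α i z := by
    intro z hz
    have h2 : ‖z - c‖ < 1 / 32 := by simpa [hG, dist_eq_norm] using hz
    have h3 := (coord_le i (z - c)).trans h2.le
    have h4 : c i = 1 / 16 := by simp [hc]
    have h5 : 1 / 32 ≤ z i := by
      rw [PiLp.sub_apply, h4, abs_le] at h3; linarith [h3.1]
    have hz0 : 0 < ‖z‖ := by
      have := coord_le i z
      rw [abs_of_pos (by linarith)] at this; linarith
    have h6 : (1 / 32 : ℝ) ≤ wf α i z := by
      unfold wf
      calc (1 / 32 : ℝ) = (1 / 32 : ℝ) ^ (1 : ℝ) := by simp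
        _ ≤ (1 / 32 : ℝ) ^ α :=
          Real.rpow_le_rpow_of_exponent_ge (by norm_num) (by norm_num) h1.le
        _ ≤ _ := Real.rpow_le_rpow (by norm_num) (h5.trans (le_max_left _ _)) h0.le
    have h7 : (32 / 3 : ℝ) ^ 2 ≤ ‖z‖ ^ (-(N : ℝ)) := by
      rw [Real.rpow_neg hz0.le, Real.rpow_natCast, ← inv_pow]
      have h8 : (32 / 3 : ℝ) ≤ ‖z‖⁻¹ := by
        rw [le_inv_comm₀ (by norm_num) hz0]; norm_num; exact hGn z hz
      calc (32 / 3 : ℝ) ^ 2 ≤ ‖z‖⁻¹ ^ 2 := by gcongr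
        _ ≤ _ := pow_le_pow_right₀ (by linarith) hN
    unfold hf
    calc (2 : ℝ) ≤ 1 / 32 * (32 / 3 : ℝ) ^ 2 := by norm_num
      _ ≤ _ := by gcongr
  set κ := volume.real G * (m * 2 ^ (-p)) / 2 with hκ
  have hκ0 : 0 < κ := by positivity
  refine ⟨κ, hκ0, fun e he ht => ?_⟩
  obtain ⟨C, ε₀, hε₀, hC⟩ := hf_lower hN h0 h1 i e he ht
  set b := hf α i e with hb
  have hb0 : 0 ≤ b := hf_nonneg _ _ _
  have hb1 : b ≤ 1 := by simpa [he] using hf_le h0 i e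
  set M := q * (|C| + 1) with hM
  have hM0 : 0 < M := by positivity
  refine ⟨min ε₀ (min (1 / 2) ((κ / M) ^ (1 / (2 - 2 * α)))), by positivity, fun ε hε hlt => ?_⟩
  have hlt1 : ε < ε₀ := hlt.trans_le (min_le_left _ _)
  have hlt2 : ε < 1 / 2 := hlt.trans_le ((min_le_right _ _).trans (min_le_left _ _))
  have hlt3 : ε < (κ / M) ^ (1 / (2 - 2 * α)) :=
    hlt.trans_le ((min_le_right _ _).trans (min_le_right _ _))
  have hpow : ε ^ (2 - 2 * α) ≤ κ / M := by
    have h2 : 0 < 2 - 2 * α := by linarith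
    calc ε ^ (2 - 2 * α) ≤ ((κ / M) ^ (1 / (2 - 2 * α))) ^ (2 - 2 * α) :=
          Real.rpow_le_rpow hε.le hlt3.le h2.le
      _ = κ / M := by
          rw [← Real.rpow_mul (by positivity), one_div_mul_cancel h2.ne', Real.rpow_one]
  have hCε := hC ε hε hlt1
  set S := {z : EuclideanSpace ℝ (Fin N) | ε < ‖z - e‖} with hS
  have hSm : MeasurableSet S := measurableSet_lt measurable_const (by fun_prop)
  set K : EuclideanSpace ℝ (Fin N) → ℝ := fun z => ‖z - e‖ ^ (-p) with hK
  have hK0 : ∀ z, 0 ≤ K z := fun z => by positivity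
  have hKi : IntegrableOn K S := kernel_int' (by linarith) hε e
  have hhi : IntegrableOn (fun z => (hf α i z - b) * K z) S := by
    refine ((hf_int hN h0 h1 i hε e).sub (hKi.const_mul b)).congr (.of_forall fun z => ?_)
    simp [hK, hp]; ring
  have hvi : IntegrableOn (fun z => (vf α q i z - vf α q i e) * K z) S := by
    refine ((vf_int hN h0 (by linarith) hq hβ0 hβ i hε e).sub
      (hKi.const_mul (vf α q i e))).congr (.of_forall fun z => ?_)
    simp [hK, hp]; ring
  set A := q * b ^ (q - 1) with hA
  have hA0 : 0 ≤ A := by positivity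
  have hAq : A ≤ q := by
    have : b ^ (q - 1) ≤ 1 := Real.rpow_le_one hb0 hb1 (by linarith)
    rw [hA]; nlinarith
  set D : EuclideanSpace ℝ (Fin N) → ℝ := fun z =>
    (vf α q i z - vf α q i e - A * (hf α i z - b)) * K z with hD
  have hDi : IntegrableOn D S := by
    refine (hvi.sub (hhi.const_mul A)).congr (.of_forall fun z => ?_)
    simp [hD]; ring
  have hD0 : ∀ z, 0 ≤ D z := fun z =>
    mul_nonneg (breg_nonneg hq1 (hf_nonneg _ _ _) hb0) (hK0 z)
  have hGS : G ⊆ S := by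
    intro z hz
    have h2 := hGn z hz
    have h3 := norm_sub_norm_le e z
    rw [he, norm_sub_rev] at h3
    show ε < ‖z - e‖
    linarith
  have hGD : volume.real G * (m * 2 ^ (-p)) ≤ ∫ z in S, D z := by
    calc volume.real G * (m * 2 ^ (-p)) = ∫ z in G, m * 2 ^ (-p) := by
          rw [setIntegral_const, smul_eq_mul]
      _ ≤ ∫ z in G, D z := by
          refine setIntegral_mono_on (integrableOn_const measure_ball_lt_top.ne)
            (hDi.mono_set hGS) measurableSet_ball fun z hz => ?_
          have h2 : m ≤ vf α q i z - vf α q i e - A * (hf α i z - b) :=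
            breg_lower hq1 (hGh z hz) hb0 hb1
          have h3 : (2 : ℝ) ^ (-p) ≤ K z := by
            have hpos : 0 < ‖z - e‖ := hε.trans (hGS hz)
            have hle : ‖z - e‖ ≤ 2 := by
              have := norm_sub_le z e
              have := hGn z hz
              linarith
            exact Real.rpow_le_rpow_of_nonpos hpos hle (by linarith)
          exact mul_le_mul h2 h3 (by positivity) (hm0.le.trans h2)
      _ ≤ ∫ z in S, D z :=
          setIntegral_mono_set hDi (.of_forall hD0) hGS.eventuallyLE
  have hsplit : ∫ z in S, (vf α q i z - vf α q i e) * K z =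
      A * (∫ z in S, (hf α i z - b) * K z) + ∫ z in S, D z := by
    rw [← integral_const_mul, ← integral_add (hhi.const_mul A) hDi]
    congr 1; ext z; simp only [hD]; ring
  rw [hsplit]
  have h9 : -κ ≤ A * (∫ z in S, (hf α i z - b) * K z) := by
    have hx : C * ε ^ (2 - 2 * α) ≤ (|C| + 1) * (κ / M) :=
      mul_le_mul (by linarith [le_abs_self C]) hpow (by positivity) (by positivity)
    have hy : (|C| + 1) * (κ / M) = κ / q := by rw [hM]; field_simp
    have hz : -(κ / q) ≤ ∫ z in S, (hf α i z - b) * K z := by linarith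
    calc -κ = q * (-(κ / q)) := by field_simp
      _ ≤ A * (-(κ / q)) := by
          have : 0 ≤ κ / q := by positivity
          nlinarith
      _ ≤ _ := mul_le_mul_of_nonneg_left hz hA0
  have : volume.real G * (m * 2 ^ (-p)) = 2 * κ := by rw [hκ]; ring
  linarith

/-- Scaled version. -/
lemma vf_lower_scaled {N : ℕ} (hN : 2 ≤ N) {α β q : ℝ} (h0 : 0 < α) (h1 : α < 1) (hq1 : 1 < q)
    (hq : ((N : ℝ) - α) * q = β) (hβ : β < N) (i : Fin N) :
    ∃ κ : ℝ, 0 < κ ∧ ∀ x : EuclideanSpace ℝ (Fin N), 0 < x i →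
      ∃ ε₀ : ℝ, 0 < ε₀ ∧ ∀ ε, 0 < ε → ε < ε₀ →
      ‖x‖ ^ ((N : ℝ) - β - ((N : ℝ) + 2 * α)) * κ ≤
      ∫ z in {z : EuclideanSpace ℝ (Fin N) | ε < ‖z - x‖},
        (vf α q i z - vf α q i x) * ‖z - x‖ ^ (-((N : ℝ) + 2 * α)) := by
  obtain ⟨κ, hκ, H⟩ := vf_lower hN h0 h1 hq1 hq hβ i
  refine ⟨κ, hκ, fun x hx => ?_⟩
  have hR : 0 < ‖x‖ := hx.trans_le ((le_abs_self _).trans (coord_le i x))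
  set R := ‖x‖ with hRdef
  obtain ⟨ε₀, hε₀, He⟩ := H (R⁻¹ • x) (by rw [norm_smul, norm_inv, norm_norm]; exact inv_mul_cancel₀ hR.ne')
    (by simp; positivity)
  refine ⟨R * ε₀, by positivity, fun ε hε hlt => ?_⟩
  have He' := He (ε / R) (by positivity) (by rw [div_lt_iff₀ hR]; linarith)
  set e := R⁻¹ • x with he
  have hxe : x = R • e := by rw [he, smul_inv_smul₀ hR.ne']
  set p := (N : ℝ) + 2 * α with hp
  have key := Measure.setIntegral_comp_smul_of_pos (μ := volume)
    (fun z : EuclideanSpace ℝ (Fin N) => (vf α q i z - vf α q i x) * ‖z - x‖ ^ (-p))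
    {z : EuclideanSpace ℝ (Fin N) | ε / R < ‖z - e‖} hR
  have hnorm : ∀ z : EuclideanSpace ℝ (Fin N), ‖R • z - x‖ = R * ‖z - e‖ := by
    intro z; rw [hxe, ← smul_sub, norm_smul, Real.norm_of_nonneg hR.le]
  have hset : R • {z : EuclideanSpace ℝ (Fin N) | ε / R < ‖z - e‖} = {z | ε < ‖z - x‖} := by
    ext z
    rw [mem_smul_set_iff_inv_smul_mem₀ hR.ne']
    have := hnorm (R⁻¹ • z)
    rw [smul_inv_smul₀ hR.ne'] at this
    simp only [mem_ofPred_eq, this, div_lt_iff₀ hR, mul_comm]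
  have hfun : (fun z : EuclideanSpace ℝ (Fin N) =>
      (vf α q i (R • z) - vf α q i x) * ‖R • z - x‖ ^ (-p)) = fun z =>
      (R ^ (-β) * R ^ (-p)) * ((vf α q i z - vf α q i e) * ‖z - e‖ ^ (-p)) := by
    ext z
    rw [hnorm, Real.mul_rpow hR.le (norm_nonneg _), vf_smul hq i hR]
    conv_lhs => rw [hxe]
    rw [vf_smul hq i hR]; ring
  rw [hset, hfun, integral_const_mul, finrank_euclideanSpace_fin, smul_eq_mul,
    eq_inv_mul_iff_mul_eq₀ (by positivity)] at key
  rw [← key]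
  have : R ^ ((N : ℝ) - β - p) = R ^ N * (R ^ (-β) * R ^ (-p)) := by
    rw [← Real.rpow_natCast, ← Real.rpow_add hR, ← Real.rpow_add hR]; congr 1; ring
  rw [this, mul_assoc]
  gcongr

/-- The truncated barrier. -/
noncomputable def pf {N : ℕ} (α q : ℝ) (i : Fin N) (z : EuclideanSpace ℝ (Fin N)) : ℝ :=
  {z : EuclideanSpace ℝ (Fin N) | 1 ≤ ‖z‖}.indicator (vf α q i) z

lemma pf_nonneg {N : ℕ} (α q : ℝ) (i : Fin N) (z : EuclideanSpace ℝ (Fin N)) : 0 ≤ pf α q i z :=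
  indicator_nonneg (fun _ _ => vf_nonneg _ _ _ _) _

lemma pf_le {N : ℕ} (α q : ℝ) (i : Fin N) (z : EuclideanSpace ℝ (Fin N)) :
    pf α q i z ≤ vf α q i z :=
  indicator_le_self' (fun _ _ => vf_nonneg _ _ _ _) _

lemma pf_eq {N : ℕ} (α q : ℝ) (i : Fin N) {z : EuclideanSpace ℝ (Fin N)} (hz : 1 ≤ ‖z‖) :
    pf α q i z = vf α q i z := indicator_of_mem (s := {z | 1 ≤ ‖z‖}) hz _

lemma pf_eq_zero {N : ℕ} (α q : ℝ) (i : Fin N) {z : EuclideanSpace ℝ (Fin N)} (hz : ‖z‖ < 1) :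
    pf α q i z = 0 := indicator_of_notMem (s := {z | 1 ≤ ‖z‖}) (by simpa using hz) _

lemma pf_meas {N : ℕ} {α : ℝ} (h0 : 0 < α) (q : ℝ) (i : Fin N) :
    Measurable (pf (N := N) α q i) :=
  (vf_meas h0 q i).indicator (measurableSet_le measurable_const measurable_norm)

lemma pf_int {N : ℕ} (hN : 2 ≤ N) {α β q ε : ℝ} (h0 : 0 < α)
    (hq0 : 0 ≤ q) (hq : ((N : ℝ) - α) * q = β) (hβ0 : 0 ≤ β) (hβ : β < N) (i : Fin N)
    (hε : 0 < ε) (e : EuclideanSpace ℝ (Fin N)) :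
    IntegrableOn (fun z => pf α q i z * ‖z - e‖ ^ (-((N : ℝ) + 2 * α))) {z | ε < ‖z - e‖} := by
  refine sing_int hN (γ := β) hβ0 hβ (by linarith) hε e _ (pf_meas h0 q i) ?_
  intro z
  rw [abs_of_nonneg (pf_nonneg _ _ _ _)]
  exact (pf_le _ _ _ _).trans (vf_le h0 hq0 hq i z)

lemma pf_int' {N : ℕ} (hN : 2 ≤ N) {α β q ε : ℝ} (h0 : 0 < α)
    (hq0 : 0 ≤ q) (hq : ((N : ℝ) - α) * q = β) (hβ0 : 0 ≤ β) (hβ : β < N) (i : Fin N)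
    (hε : 0 < ε) (e : EuclideanSpace ℝ (Fin N)) (a : ℝ) :
    IntegrableOn (fun z => (pf α q i z - a) * ‖z - e‖ ^ (-((N : ℝ) + 2 * α)))
      {z | ε < ‖z - e‖} := by
  refine ((pf_int hN h0 hq0 hq hβ0 hβ i hε e).sub
    ((kernel_int' (r := (N : ℝ) + 2 * α) (by linarith) hε e).const_mul a)).congr
    (.of_forall fun z => ?_)
  simp; ring

lemma pf_lower {N : ℕ} (hN : 2 ≤ N) {α β q : ℝ} (h0 : 0 < α) (h1 : α < 1) (hq1 : 1 < q)
    (hq : ((N : ℝ) - α) * q = β) (hβ : β < N) (i : Fin N) :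
    ∃ R₀ : ℝ, 2 ≤ R₀ ∧ ∀ x : EuclideanSpace ℝ (Fin N), 0 < x i → R₀ < ‖x‖ →
      ∃ κ ε₀ : ℝ, 0 < κ ∧ 0 < ε₀ ∧ ∀ ε, 0 < ε → ε < ε₀ → κ ≤
      ∫ z in {z : EuclideanSpace ℝ (Fin N) | ε < ‖z - x‖},
        (pf α q i z - pf α q i x) * ‖z - x‖ ^ (-((N : ℝ) + 2 * α)) := by
  have hN' : (2 : ℝ) ≤ N := by exact_mod_cast hN
  have hβ0 : 0 ≤ β := by rw [← hq]; exact mul_nonneg (by linarith) (by linarith)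
  obtain ⟨κ, hκ, H⟩ := vf_lower_scaled hN h0 h1 hq1 hq hβ i
  set p := (N : ℝ) + 2 * α with hp
  obtain ⟨I, hI⟩ : ∃ I : ℝ, I = ∫ z in Metric.ball (0 : EuclideanSpace ℝ (Fin N)) 2,
    ‖z‖ ^ (-β) := ⟨_, rfl⟩
  have hI0 : 0 ≤ I := by rw [hI]; exact integral_nonneg fun z => by positivity
  have h4 : 0 ≤ 2 ^ p * I / κ := by positivity
  obtain ⟨T, hT⟩ : ∃ T : ℝ, T = (2 ^ p * I / κ) ^ (1 / ((N : ℝ) - β)) := ⟨_, rfl⟩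
  have hT0 : 0 ≤ T := by rw [hT]; positivity
  refine ⟨max 2 T, le_max_left _ _, fun x hx hxR => ?_⟩
  obtain ⟨ε₀, hε₀, He⟩ := H x hx
  have hR2 : 2 < ‖x‖ := (le_max_left _ _).trans_lt hxR
  have hRT : T < ‖x‖ := (le_max_right _ _).trans_lt hxR
  have hR : 0 < ‖x‖ := by linarith
  set R := ‖x‖ with hRdef
  have hNβ : 0 < (N : ℝ) - β := by linarith
  have hbig : 2 ^ p * I < R ^ ((N : ℝ) - β) * κ := by
    have h2 : T ^ ((N : ℝ) - β) < R ^ ((N : ℝ) - β) := Real.rpow_lt_rpow hT0 hRT hNβ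
    have h3 : T ^ ((N : ℝ) - β) = 2 ^ p * I / κ := by
      have h5 := Real.rpow_mul h4 (1 / ((N : ℝ) - β)) ((N : ℝ) - β)
      rw [one_div_mul_cancel hNβ.ne', Real.rpow_one] at h5
      rw [hT]; exact h5.symm
    rw [h3, div_lt_iff₀ hκ] at h2
    exact h2
  refine ⟨R ^ ((N : ℝ) - β - p) * κ - 2 ^ p * R ^ (-p) * I, ε₀, ?_, hε₀, fun ε hε hlt => ?_⟩
  · have : R ^ ((N : ℝ) - β - p) = R ^ ((N : ℝ) - β) * R ^ (-p) := by
      rw [← Real.rpow_add hR]; congr 1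
    rw [this]
    have h2 : 0 < R ^ (-p) := by positivity
    nlinarith
  have He' := He ε hε hlt
  set S := {z : EuclideanSpace ℝ (Fin N) | ε < ‖z - x‖} with hS
  have hSm : MeasurableSet S := measurableSet_lt measurable_const (by fun_prop)
  have hi1 := pf_int' hN h0 (by linarith) hq hβ0 hβ i hε x (pf α q i x)
  have hi2 := (vf_int hN h0 (by linarith) hq hβ0 hβ i hε x).sub
    (pf_int hN h0 (by linarith) hq hβ0 hβ i hε x)
  have hsplit : ∫ z in S, (vf α q i z - vf α q i x) * ‖z - x‖ ^ (-p) =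
      (∫ z in S, (pf α q i z - pf α q i x) * ‖z - x‖ ^ (-p)) +
      ∫ z in S, (vf α q i z * ‖z - x‖ ^ (-p) - pf α q i z * ‖z - x‖ ^ (-p)) := by
    refine Eq.trans ?_ (integral_add hi1 hi2)
    congr 1; ext z
    rw [pf_eq α q i (z := x) (by linarith)]
    simp [hp]; ring
  have hloss : ∫ z in S, (vf α q i z * ‖z - x‖ ^ (-p) - pf α q i z * ‖z - x‖ ^ (-p)) ≤
      2 ^ p * R ^ (-p) * I := by
    have horig : Integrable ((Metric.ball (0 : EuclideanSpace ℝ (Fin N)) 2).indicator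
        (fun z => 2 ^ p * R ^ (-p) * ‖z‖ ^ (-β))) :=
      (integrable_indicator_iff measurableSet_ball).2 ((origin_int hN hβ).const_mul _)
    have hQ0 : ∀ z, 0 ≤ (Metric.ball (0 : EuclideanSpace ℝ (Fin N)) 2).indicator
        (fun z => 2 ^ p * R ^ (-p) * ‖z‖ ^ (-β)) z := fun z =>
      indicator_nonneg (fun _ _ => by positivity) _
    have hQint : ∫ z, (Metric.ball (0 : EuclideanSpace ℝ (Fin N)) 2).indicator
        (fun z => 2 ^ p * R ^ (-p) * ‖z‖ ^ (-β)) z = 2 ^ p * R ^ (-p) * I := by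
      rw [integral_indicator measurableSet_ball, integral_const_mul, hI]
    rw [← hQint]
    refine le_trans ?_ (setIntegral_le_integral (s := S) horig (.of_forall hQ0))
    refine setIntegral_mono_on hi2 horig.integrableOn hSm fun z hz => ?_
    rcases le_or_gt 1 ‖z‖ with hz1 | hz1
    · rw [pf_eq α q i hz1, sub_self]; exact hQ0 z
    · have hzb : z ∈ Metric.ball (0 : EuclideanSpace ℝ (Fin N)) 2 := by
        rw [mem_ball_zero_iff]; linarith
      rw [pf_eq_zero α q i hz1, indicator_of_mem hzb, zero_mul, sub_zero]
      have hd : R / 2 ≤ ‖z - x‖ := by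
        have := norm_sub_norm_le x z
        rw [norm_sub_rev] at this; linarith
      have hk : ‖z - x‖ ^ (-p) ≤ 2 ^ p * R ^ (-p) := by
        have h3 : ‖z - x‖ ^ (-p) ≤ (R / 2) ^ (-p) :=
          Real.rpow_le_rpow_of_nonpos (by positivity) hd (by linarith)
        have h4 : (R / 2) ^ (-p) = 2 ^ p * R ^ (-p) := by
          rw [Real.div_rpow hR.le (by norm_num), Real.rpow_neg (by norm_num : (0:ℝ) ≤ 2),
            div_inv_eq_mul, mul_comm]
        rw [← h4]; exact h3
      rw [mul_comm]
      exact mul_le_mul hk (vf_le h0 (by linarith) hq i z) (vf_nonneg _ _ _ _) (by positivity)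
  linarith

lemma vf_zero {N : ℕ} {α q : ℝ} (h0 : 0 < α) (hq : 0 < q) (i : Fin N)
    {z : EuclideanSpace ℝ (Fin N)} (hz : z i ≤ 0) : vf α q i z = 0 := by
  unfold vf hf wf
  rw [max_eq_right hz, Real.zero_rpow h0.ne', zero_mul, Real.zero_rpow hq.ne']

lemma vf_contOn {N : ℕ} {α q : ℝ} (h0 : 0 < α) (hq : 0 < q) (i : Fin N) :
    ContinuousOn (vf (N := N) α q i) {z | 1 ≤ ‖z‖} := by
  unfold vf hf
  refine ContinuousOn.rpow_const ?_ (fun _ _ => Or.inr hq.le)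
  refine (wf_cont h0 i).continuousOn.mul ?_
  refine ContinuousOn.rpow_const continuous_norm.continuousOn (fun z hz => Or.inl ?_)
  have : (1 : ℝ) ≤ ‖z‖ := hz
  linarith

lemma no_touch {N : ℕ} (U P : EuclideanSpace ℝ (Fin N) → ℝ) (x : EuclideanSpace ℝ (Fin N))
    {p c κ ε₀ : ℝ} (hc : 0 < c) (hκ : 0 < κ) (hε₀ : 0 < ε₀)
    (hUP : ∀ z, c * (P z - P x) ≤ U z - U x)
    (hPi : ∀ ε, 0 < ε → IntegrableOn (fun z => (P z - P x) * ‖z - x‖ ^ (-p)) {z | ε < ‖z - x‖})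
    (hP : ∀ ε, 0 < ε → ε < ε₀ → κ ≤ ∫ z in {z : EuclideanSpace ℝ (Fin N) | ε < ‖z - x‖},
      (P z - P x) * ‖z - x‖ ^ (-p))
    (hUi : Integrable (fun y => nlD U x y * ‖y‖ ^ (-p)))
    (hU : ∫ y, nlD U x y * ‖y‖ ^ (-p) ≤ 0) : False := by
  set S : ℝ → Set (EuclideanSpace ℝ (Fin N)) := fun ε => {y | ε < ‖y‖} with hS
  have hSm : ∀ ε, MeasurableSet (S ε) := fun ε => measurableSet_lt measurable_const measurable_norm
  have main : ∀ ε, 0 < ε → ε < ε₀ → 2 * c * κ ≤ ∫ y in S ε, nlD U x y * ‖y‖ ^ (-p) := by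
    intro ε hε hlt
    set F : EuclideanSpace ℝ (Fin N) → ℝ := fun y => (P (x + y) - P x) * ‖y‖ ^ (-p) with hF
    have hFi : IntegrableOn F (S ε) := by
      have := (shift_integrable (fun z => (P z - P x) * ‖z - x‖ ^ (-p)) x ε).2 (hPi ε hε)
      simpa using this
    have hFl : κ ≤ ∫ y in S ε, F y := by
      have := shift_integral (fun z => (P z - P x) * ‖z - x‖ ^ (-p)) x ε
      simp only [add_sub_cancel_left] at this
      rw [hF, this]; exact hP ε hε hlt
    set G := (S ε).indicator F with hG
    have hGi : Integrable G := (integrable_indicator_iff (hSm ε)).2 hFi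
    have hGl : κ ≤ ∫ y, G y := by rw [hG, integral_indicator (hSm ε)]; exact hFl
    have hGn : ∫ y, G (-y) = ∫ y, G y := integral_neg_eq_self G volume
    rw [← integral_indicator (hSm ε)]
    calc 2 * c * κ ≤ c * ((∫ y, G y) + ∫ y, G (-y)) := by rw [hGn]; nlinarith
      _ = ∫ y, c * (G y + G (-y)) := by
          rw [integral_const_mul, integral_add hGi hGi.comp_neg]
      _ ≤ _ := by
          refine integral_mono ((hGi.add hGi.comp_neg).const_mul c)
            (hUi.indicator (hSm ε)) fun y => ?_
          by_cases hy : y ∈ S ε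
          · have hy' : -y ∈ S ε := by simpa [hS] using hy
            simp only [hG, indicator_of_mem hy, indicator_of_mem hy', hF, norm_neg]
            have h1 := hUP (x + y)
            have h2 := hUP (x - y)
            have h3 : 0 ≤ ‖y‖ ^ (-p) := by positivity
            rw [← sub_eq_add_neg, ← add_mul, ← mul_assoc]
            refine mul_le_mul_of_nonneg_right ?_ h3
            unfold nlD; linarith
          · have hy' : -y ∉ S ε := by simpa [hS] using hy
            simp only [hG, indicator_of_notMem hy, indicator_of_notMem hy']
            simp
  have hmono : Monotone fun n : ℕ => S (1 / ((n : ℝ) + 1)) := by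
    intro a b hab y hy
    have h1 : 1 / ((a : ℝ) + 1) < ‖y‖ := hy
    have h2 : 1 / ((b : ℝ) + 1) ≤ 1 / ((a : ℝ) + 1) := Nat.one_div_le_one_div hab
    exact h2.trans_lt h1
  have hlim := tendsto_setIntegral_of_monotone (μ := volume)
    (f := fun y => nlD U x y * ‖y‖ ^ (-p)) (fun n : ℕ => hSm (1 / ((n : ℝ) + 1))) hmono
    hUi.integrableOn
  have hfull : ∫ y in ⋃ n : ℕ, S (1 / ((n : ℝ) + 1)), nlD U x y * ‖y‖ ^ (-p) =
      ∫ y, nlD U x y * ‖y‖ ^ (-p) := by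
    refine setIntegral_eq_integral_of_forall_compl_eq_zero fun y hy => ?_
    have : y = 0 := by
      by_contra hne
      obtain ⟨n, hn⟩ := exists_nat_one_div_lt (norm_pos_iff.2 hne)
      exact hy (mem_iUnion.2 ⟨n, hn⟩)
    subst this
    have : nlD U x 0 = 0 := by unfold nlD; simp; ring
    rw [this, zero_mul]
  rw [hfull] at hlim
  have hev : ∀ᶠ n : ℕ in Filter.atTop,
      2 * c * κ ≤ ∫ y in S (1 / ((n : ℝ) + 1)), nlD U x y * ‖y‖ ^ (-p) := by
    have := (tendsto_one_div_add_atTop_nhds_zero_nat (𝕜 := ℝ)).eventually_lt_const hε₀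
    filter_upwards [this] with n hn
    exact main _ (by positivity) hn
  have := ge_of_tendsto hlim hev
  have : 0 < 2 * c * κ := by positivity
  linarith

lemma barrier_compare {N : ℕ} (hN : 2 ≤ N) {α β q : ℝ} (h0 : 0 < α) (h1 : α < 1) (hq1 : 1 < q)
    (hq : ((N : ℝ) - α) * q = β) (hβ : β < N) (i : Fin N) (U : EuclideanSpace ℝ (Fin N) → ℝ)
    (hUc : Continuous U) (hU0 : ∀ x, 0 ≤ U x)
    (hUpos : ∀ x : EuclideanSpace ℝ (Fin N), 0 ≤ x i → 0 < U x)
    (hUs : ∀ x : EuclideanSpace ℝ (Fin N), 0 < x i →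
      Integrable (fun y => nlD U x y * ‖y‖ ^ (-((N : ℝ) + 2 * α))) ∧
      ∫ y, nlD U x y * ‖y‖ ^ (-((N : ℝ) + 2 * α)) ≤ 0) :
    ∃ c : ℝ, 0 < c ∧ ∀ x, c * pf α q i x ≤ U x := by
  have hN' : (2 : ℝ) ≤ N := by exact_mod_cast hN
  have hq0 : 0 < q := by linarith
  have hβ0 : 0 < β := by rw [← hq]; exact mul_pos (by linarith) (by linarith)
  obtain ⟨R₀, hR₀, HR⟩ := pf_lower hN h0 h1 hq1 hq hβ i
  have hHc : IsClosed {x : EuclideanSpace ℝ (Fin N) | 0 ≤ x i} :=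
    isClosed_le continuous_const (by fun_prop)
  have hAc : IsCompact (Metric.closedBall (0 : EuclideanSpace ℝ (Fin N)) R₀ ∩ {x | 0 ≤ x i}) :=
    (isCompact_closedBall _ _).inter_right hHc
  obtain ⟨xm, hxm, hmin⟩ := hAc.exists_isMinOn ⟨0, by simp; linarith⟩ hUc.continuousOn
  have hc : 0 < U xm := hUpos _ hxm.2
  obtain ⟨c, hcdef⟩ : ∃ c, c = U xm := ⟨_, rfl⟩
  rw [← hcdef] at hc
  refine ⟨c, hc, fun x1 => ?_⟩
  by_contra! hx1
  have hpf1 : ∀ x, 0 < pf α q i x → 1 ≤ ‖x‖ ∧ 0 < x i := by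
    intro x hx
    have ha : 1 ≤ ‖x‖ := by
      by_contra! h
      rw [pf_eq_zero _ _ _ h] at hx; exact lt_irrefl _ hx
    refine ⟨ha, ?_⟩
    by_contra! h
    rw [pf_eq _ _ _ ha, vf_zero h0 hq0 i h] at hx; exact lt_irrefl _ hx
  have hposc : ∀ x, U x < c * pf α q i x → 0 < pf α q i x := by
    intro x hx
    exact pos_of_mul_pos_right ((hU0 x).trans_lt hx) hc.le
  obtain ⟨hx1n, hx1i⟩ := hpf1 x1 (hposc x1 hx1)
  set d := c * pf α q i x1 - U x1 with hd
  have hd0 : 0 < d := by linarith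
  have hev := (tendsto_rpow_neg_atTop hβ0).eventually_lt_const (by positivity : 0 < d / c)
  obtain ⟨R2, hR2⟩ := Filter.eventually_atTop.1 hev
  set R3 := max R2 ‖x1‖ with hR3
  set L := (Metric.closedBall (0 : EuclideanSpace ℝ (Fin N)) R3 ∩ {x | 0 ≤ x i}) ∩ {x | 1 ≤ ‖x‖}
    with hL
  have hLc : IsCompact L := ((isCompact_closedBall _ _).inter_right hHc).inter_right
    (isClosed_le continuous_const continuous_norm)
  have hx1L : x1 ∈ L := ⟨⟨by simp [hR3], hx1i.le⟩, hx1n⟩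
  obtain ⟨x0, hx0L, hx0min⟩ := hLc.exists_isMinOn ⟨x1, hx1L⟩ (f := fun x => U x - c * vf α q i x)
    (hUc.continuousOn.sub (((vf_contOn h0 hq0 i).mono fun x hx => hx.2).const_mul c))
  have hx0n : 1 ≤ ‖x0‖ := hx0L.2
  have hle1 : U x0 - c * pf α q i x0 ≤ -d := by
    have := hx0min hx1L
    simp only [mem_ofPred_eq] at this
    rw [← pf_eq α q i hx0n, ← pf_eq α q i hx1n] at this
    linarith
  have hglob : ∀ z, U x0 - c * pf α q i x0 ≤ U z - c * pf α q i z := by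
    intro z
    rcases (pf_nonneg α q i z).eq_or_lt with hz | hz
    · rw [← hz]; linarith [hU0 z]
    · obtain ⟨hz1, hzi⟩ := hpf1 z hz
      by_cases hzR : ‖z‖ ≤ R3
      · have hzL : z ∈ L := ⟨⟨by simpa using hzR, hzi.le⟩, hz1⟩
        have := hx0min hzL
        simp only [mem_ofPred_eq] at this
        rwa [← pf_eq α q i hx0n, ← pf_eq α q i hz1] at this
      · push Not at hzR
        have h2 := hR2 ‖z‖ ((le_max_left _ _).trans hzR.le)
        have h3 : pf α q i z < d / c :=
          ((pf_le _ _ _ _).trans (vf_le h0 hq0.le hq i z)).trans_lt h2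
        rw [lt_div_iff₀ hc] at h3
        linarith [hU0 z]
  have hx0lt : U x0 < c * pf α q i x0 := by linarith
  obtain ⟨-, hx0i⟩ := hpf1 x0 (hposc x0 hx0lt)
  have hx0R : R₀ < ‖x0‖ := by
    by_contra! h
    have h2 : U xm ≤ U x0 := hmin ⟨by simpa using h, hx0i.le⟩
    have h3 : pf α q i x0 ≤ 1 :=
      ((pf_le _ _ _ _).trans (vf_le h0 hq0.le hq i x0)).trans
        (Real.rpow_le_one_of_one_le_of_nonpos hx0n (by linarith))
    nlinarith
  obtain ⟨κ, ε₀, hκ, hε₀, HP⟩ := HR x0 hx0i hx0R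
  exact no_touch U (pf α q i) x0 hc hκ hε₀ (fun z => by linarith [hglob z])
    (fun ε hε => pf_int' hN h0 hq0.le hq hβ0.le hβ i hε x0 _) HP (hUs x0 hx0i).1 (hUs x0 hx0i).2

end Helpers

/-- Lower bound at infinity for positive supersolutions in the half-space,
fractional-Laplacian instance of Lemma 4.2 (where `β⁺ = N - α`). -/
theorem lower_bound_at_infinity_halfspace
    (N : ℕ) (hN : 2 ≤ N) (α β : ℝ) (hα : α ∈ Set.Ioo (0 : ℝ) 1)
    (hβ : β ∈ Set.Ioo ((N : ℝ) - α) (N : ℝ))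
    (u : EuclideanSpace ℝ (Fin N) → ℝ)
    (hu_cont : Continuous u)
    (hu_nonneg : ∀ x, 0 ≤ u x)
    (hu_pos : ∀ x : EuclideanSpace ℝ (Fin N), 0 < x ⟨N - 1, by omega⟩ → 0 < u x)
    (hu_super : ∀ x : EuclideanSpace ℝ (Fin N), 0 < x ⟨N - 1, by omega⟩ →
      Integrable (fun y => nlD u x y * ‖y‖ ^ (-((N : ℝ) + 2 * α))) ∧
      ∫ y, nlD u x y * ‖y‖ ^ (-((N : ℝ) + 2 * α)) ≤ 0) :
    ∀ ω₀ : Set (EuclideanSpace ℝ (Fin N)), IsCompact ω₀ →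
      ω₀ ⊆ {e | ‖e‖ = 1 ∧ 0 < e ⟨N - 1, by omega⟩} →
      ∃ C : ℝ, 0 < C ∧ ∃ R₁ : ℝ, 0 < R₁ ∧
        ∀ x : EuclideanSpace ℝ (Fin N), x ≠ 0 → ‖x‖⁻¹ • x ∈ ω₀ → R₁ ≤ ‖x‖ →
          C * ‖x‖ ^ (-β) ≤ u x := by
  intro ω₀ hω hωs
  obtain ⟨h0, h1⟩ := hα
  obtain ⟨hβ1, hβ2⟩ := hβ
  have hN' : (2 : ℝ) ≤ N := by exact_mod_cast hN
  have hNα : 0 < (N : ℝ) - α := by linarith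
  rcases ω₀.eq_empty_or_nonempty with rfl | hne
  · exact ⟨1, one_pos, 1, one_pos, fun x _ hx => absurd hx (Set.notMem_empty _)⟩
  set i : Fin N := ⟨N - 1, by omega⟩ with hi
  obtain ⟨q, hqdef⟩ : ∃ q, q = β / ((N : ℝ) - α) := ⟨_, rfl⟩
  have hq1 : 1 < q := by rw [hqdef, one_lt_div hNα]; exact hβ1
  have hq : ((N : ℝ) - α) * q = β := by rw [hqdef]; field_simp
  set eN : EuclideanSpace ℝ (Fin N) := EuclideanSpace.single i (1 : ℝ) with heN
  have heNi : eN i = 1 := by simp [heN]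
  have heNn : ‖eN‖ = 1 := by simp [heN]
  have hshift : ∀ x : EuclideanSpace ℝ (Fin N), (x + eN) i = x i + 1 := fun x => by
    rw [PiLp.add_apply, heNi]
  have hnl : ∀ x y, nlD (fun x => u (x + eN)) x y = nlD u (x + eN) y := by
    intro x y
    unfold nlD
    have a1 : x + y + eN = x + eN + y := by abel
    have a2 : x - y + eN = x + eN - y := by abel
    simp only [a1, a2]
  obtain ⟨c, hc, hcomp⟩ := barrier_compare hN h0 h1 hq1 hq hβ2 i (fun x => u (x + eN))
    (by fun_prop) (fun x => hu_nonneg _)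
    (fun x hx => hu_pos _ (by rw [hshift]; linarith))
    (fun x hx => by
      simp only [hnl]
      exact hu_super _ (by rw [hshift]; linarith))
  obtain ⟨e0, he0, hemin⟩ := hω.exists_isMinOn hne
    (f := fun e : EuclideanSpace ℝ (Fin N) => e i) (by fun_prop)
  obtain ⟨m, hmdef⟩ : ∃ m, m = e0 i := ⟨_, rfl⟩
  have hm0 : 0 < m := by rw [hmdef]; exact (hωs he0).2
  have hm1 : m ≤ 1 := by
    have := (le_abs_self _).trans (coord_le i e0)
    rw [(hωs he0).1] at this; rw [hmdef]; exact this
  have h2m : 2 ≤ 2 / m := by rw [le_div_iff₀ hm0]; linarith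
  refine ⟨c * ((m / 2) ^ α * 2 ^ (-(N : ℝ))) ^ q, by positivity, 2 / m, by positivity,
    fun x hx hxω hxR => ?_⟩
  have hR2 : 2 ≤ ‖x‖ := h2m.trans hxR
  have hR : 0 < ‖x‖ := by linarith
  have hxi : m * ‖x‖ ≤ x i := by
    have h2 : e0 i ≤ (‖x‖⁻¹ • x) i := hemin hxω
    rw [PiLp.smul_apply, smul_eq_mul, ← hmdef, ← div_eq_inv_mul, le_div_iff₀ hR] at h2
    exact h2
  have hmx : 2 ≤ m * ‖x‖ := by rw [div_le_iff₀ hm0] at hxR; linarith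
  have hzi : m / 2 * ‖x‖ ≤ (x - eN) i := by
    rw [PiLp.sub_apply, heNi]; linarith
  have hz1 : 1 ≤ ‖x - eN‖ := by
    have := norm_sub_norm_le x eN
    rw [heNn] at this; linarith
  have hz2 : ‖x - eN‖ ≤ 2 * ‖x‖ := by
    have := norm_sub_le x eN
    rw [heNn] at this; linarith
  have hmain := hcomp (x - eN)
  simp only [sub_add_cancel] at hmain
  rw [pf_eq α q i hz1] at hmain
  refine le_trans ?_ hmain
  rw [mul_assoc]
  refine mul_le_mul_of_nonneg_left ?_ hc.le
  have hhf : ((m / 2) ^ α * 2 ^ (-(N : ℝ))) * ‖x‖ ^ (-((N : ℝ) - α)) ≤ hf α i (x - eN) := by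
    have e1 : ‖x‖ ^ (-((N : ℝ) - α)) = ‖x‖ ^ α * ‖x‖ ^ (-(N : ℝ)) := by
      rw [← Real.rpow_add hR]; congr 1; ring
    have e2 : ((m / 2) ^ α * 2 ^ (-(N : ℝ))) * ‖x‖ ^ (-((N : ℝ) - α)) =
        (m / 2 * ‖x‖) ^ α * (2 * ‖x‖) ^ (-(N : ℝ)) := by
      rw [e1, Real.mul_rpow (by positivity) hR.le, Real.mul_rpow (by norm_num) hR.le]; ring
    rw [e2]
    unfold hf wf
    refine mul_le_mul ?_ ?_ (by positivity) (by positivity)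
    · exact Real.rpow_le_rpow (by positivity) (hzi.trans (le_max_left _ _)) h0.le
    · exact Real.rpow_le_rpow_of_nonpos (by linarith) hz2 (by linarith)
  have hfin := Real.rpow_le_rpow (by positivity) hhf (by linarith : 0 ≤ q)
  rw [Real.mul_rpow (by positivity) (by positivity), ← Real.rpow_mul hR.le, neg_mul, hq] at hfin
  exact hfin
end
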